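/- arXiv:math/0507062 — 3 statements merged into one kernel-verified Lean document; each statement's English description precedes it below -/
import Mathlib

section
/- Let X be a Valdivia compact space and let f : X → Y be a retraction onto a compact Hausdorff space Y of weight at most ℵ₁. Then Y is Valdivia compact. -/
open Set Filter Topology

universe u v

/-- `Σ(T)`: the points of the Tikhonov cube `[0,1]^T` with countable support. -/
def SigmaProd (T : Type*) : Set (T → unitInterval) :=
  {x | {t | x t ≠ 0}.Countable}

/-- A Valdivia embedding into the cube `[0,1]^T`. -/
def IsValdiviaEmbedding {X : Type*} [TopologicalSpace X] {T : Type*}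
    (h : X → T → unitInterval) : Prop :=
  Topology.IsEmbedding h ∧ Set.range h = closure (Set.range h ∩ SigmaProd T)

/-- A space is Valdivia compact if it admits a Valdivia embedding into some cube. -/
def IsValdivia (X : Type u) [TopologicalSpace X] : Prop :=
  ∃ (T : Type u) (h : X → T → unitInterval), IsValdiviaEmbedding h

/-- The weight of a topological space: the least cardinality of a base. -/
noncomputable def tweight (X : Type u) [TopologicalSpace X] : Cardinal.{u} :=
  sInf {c | ∃ B : Set (Set X), TopologicalSpace.IsTopologicalBasis B ∧ Cardinal.mk ↥B = c}


lemma vald_countable_dep {K : Type*} [TopologicalSpace K] [CompactSpace K] {J : Type*}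
    (e : J → K → unitInterval) (he : ∀ j, Continuous (e j))
    (hinj : ∀ x y, (∀ j, e j x = e j y) → x = y)
    (φ : K → unitInterval) (hφ : Continuous φ) :
    ∃ N : Set J, N.Countable ∧ ∀ x y, (∀ j ∈ N, e j x = e j y) → φ x = φ y := by
  have key : ∀ n : ℕ, ∃ N : Finset J, ∀ x y, (∀ j ∈ N, e j x = e j y) →
      dist (φ x) (φ y) < 1 / ((n : ℝ) + 1) := by
    intro n
    have hcl : IsClosed {p : K × K | 1 / ((n : ℝ) + 1) ≤ dist (φ p.1) (φ p.2)} :=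
      isClosed_le continuous_const (by fun_prop)
    obtain ⟨N, hN⟩ := hcl.isCompact.elim_finite_subcover
      (fun j : J => {p : K × K | e j p.1 ≠ e j p.2})
      (fun j => isOpen_ne_fun ((he j).comp continuous_fst) ((he j).comp continuous_snd))
      (by
        rintro ⟨x, y⟩ hxy
        simp only [mem_iUnion, mem_setOf_eq]
        by_contra! hcon
        have := hinj x y hcon
        subst this
        simp only [mem_setOf_eq, dist_self] at hxy
        have : (0:ℝ) < 1 / ((n : ℝ) + 1) := by positivity
        linarith)
    refine ⟨N, fun x y h => ?_⟩
    by_contra hcon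
    have h1 : (x, y) ∈ {p : K × K | 1 / ((n : ℝ) + 1) ≤ dist (φ p.1) (φ p.2)} := not_lt.1 hcon
    have := hN h1
    simp only [mem_iUnion, mem_setOf_eq] at this
    obtain ⟨j, hj, hne⟩ := this
    exact hne (h j hj)
  choose N hN using key
  refine ⟨⋃ n, (N n : Set J), countable_iUnion fun n => (N n).countable_toSet, ?_⟩
  intro x y h
  by_contra hne
  obtain ⟨n, hn⟩ := exists_nat_one_div_lt (dist_pos.2 hne)
  have := hN n x y (fun j hj => h j (mem_iUnion.2 ⟨n, hj⟩))
  linarith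

/-- Closed under a finitary set-valued operation. -/
def VCl {W : Type*} (Ψ : Finset W → Set W) (Z : Set W) : Prop :=
  ∀ F : Finset W, (F : Set W) ⊆ Z → Ψ F ⊆ Z

lemma VCl.iUnion {W ι : Type*} [Nonempty ι] {Ψ : Finset W → Set W} {Z : ι → Set W}
    (hZ : ∀ i, VCl Ψ (Z i)) (hd : Directed (· ⊆ ·) Z) : VCl Ψ (⋃ i, Z i) := by
  intro F hF
  obtain ⟨i, hi⟩ := hd.exists_mem_subset_of_finset_subset_biUnion hF
  exact (hZ i F hi).trans (subset_iUnion Z i)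

lemma vcl_exists_countable {W : Type*} (Ψ : Finset W → Set W) (hΨ : ∀ F, (Ψ F).Countable)
    (Z : Set W) (hZ : Z.Countable) : ∃ Z' : Set W, Z ⊆ Z' ∧ Z'.Countable ∧ VCl Ψ Z' := by
  let step : Set W → Set W := fun A => A ∪ ⋃ F ∈ {F : Finset W | (F : Set W) ⊆ A}, Ψ F
  let S : ℕ → Set W := fun n => step^[n] Z
  have hS : ∀ n, S (n + 1) = step (S n) := fun n => Function.iterate_succ_apply' step n Z
  have hmono : Monotone S := monotone_nat_of_le_succ fun n => by
    rw [hS]; exact subset_union_left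
  have hc : ∀ n, (S n).Countable := by
    intro n
    induction n with
    | zero => exact hZ
    | succ n ih =>
      rw [hS]
      refine ih.union (Countable.biUnion ?_ fun F _ => hΨ F)
      have := (countable_setOf_finite_subset ih)
      refine (this.preimage (f := fun F : Finset W => (F : Set W))
        Finset.coe_injective).mono ?_
      intro F hF
      exact ⟨F.finite_toSet, hF⟩
  refine ⟨⋃ n, S n, subset_iUnion S 0, countable_iUnion hc, ?_⟩
  intro F hF
  obtain ⟨n, hn⟩ := (hmono.directed_le).exists_mem_subset_of_finset_subset_biUnion hF
  refine subset_trans ?_ (subset_iUnion S (n + 1))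
  rw [hS]
  refine subset_trans ?_ subset_union_right
  exact subset_biUnion_of_mem (u := Ψ) (show F ∈ {F : Finset W | (F : Set W) ⊆ S n} from hn)

lemma vcl_closure {W : Type*} (Ψ : Finset W → Set W) (hΨ : ∀ F, (Ψ F).Countable) :
    ∃ c : Set W → Set W, (∀ Z, Z ⊆ c Z) ∧ (∀ Z, VCl Ψ (c Z)) ∧ Monotone c ∧
      ∀ Z, Z.Countable → (c Z).Countable := by
  refine ⟨fun Z => ⋂₀ {A | Z ⊆ A ∧ VCl Ψ A}, fun Z => subset_sInter fun A hA => hA.1, ?_, ?_, ?_⟩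
  · intro Z F hF
    exact subset_sInter fun A hA => hA.2 F (hF.trans (sInter_subset_of_mem hA))
  · intro Z Z' h
    exact sInter_subset_sInter fun A hA => ⟨h.trans hA.1, hA.2⟩
  · intro Z hZ
    obtain ⟨Z', h1, h2, h3⟩ := vcl_exists_countable Ψ hΨ Z hZ
    exact h2.mono (sInter_subset_of_mem ⟨h1, h3⟩)

lemma vald_good_op {T : Type*} (E : Set (T → unitInterval)) (F : Finset T)
    (hE : E ⊆ SigmaProd T) :
    ∃ P : Set T, P.Countable ∧ ∀ x ∈ closure E, ∀ v : T → Set unitInterval,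
      (∀ t ∈ F, IsOpen (v t) ∧ x t ∈ v t) →
      ∃ q ∈ E, (∀ t, q t ≠ 0 → t ∈ P) ∧ ∀ t ∈ F, q t ∈ v t := by
  let ρ : (T → unitInterval) → (F → unitInterval) := fun x t => x t
  have hρ : Continuous ρ := by fun_prop
  obtain ⟨D, hDE, hDc, hDd⟩ :=
    (TopologicalSpace.IsSeparable.of_separableSpace (ρ '' E)).exists_countable_dense_subset
  obtain ⟨Q, hQE, hQi, hQD⟩ : ∃ Q ⊆ E, InjOn ρ Q ∧ ρ '' Q = D :=
    SurjOn.exists_subset_injOn_image_eq hDE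
  have hQc : Q.Countable := by
    rw [← hQD] at hDc
    exact countable_of_injective_of_countable_image hQi hDc
  refine ⟨⋃ q ∈ Q, {t | q t ≠ 0}, hQc.biUnion fun q hq => hE (hQE hq), ?_⟩
  intro x hx v hv
  have h1 : ρ x ∈ closure D := by
    have : ρ x ∈ closure (ρ '' E) := image_closure_subset_closure_image hρ ⟨x, hx, rfl⟩
    exact closure_minimal hDd isClosed_closure this
  have ho : IsOpen (Set.pi univ (fun t : F => v t)) :=
    isOpen_set_pi finite_univ fun t _ => (hv t t.2).1
  obtain ⟨d, hd1, hd2⟩ := mem_closure_iff.1 h1 _ ho (fun t _ => (hv t t.2).2)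
  rw [← hQD] at hd2
  obtain ⟨q, hq, rfl⟩ := hd2
  exact ⟨q, hQE hq, fun t ht => mem_biUnion hq ht, fun t ht => hd1 ⟨t, ht⟩ trivial⟩

lemma vald_good {T : Type*} (E K : Set (T → unitInterval)) (hK : K = closure E)
    (P : Finset T → Set T)
    (hP : ∀ F, ∀ x ∈ closure E, ∀ v : T → Set unitInterval,
      (∀ t ∈ F, IsOpen (v t) ∧ x t ∈ v t) →
      ∃ q ∈ E, (∀ t, q t ≠ 0 → t ∈ P F) ∧ ∀ t ∈ F, q t ∈ v t)
    (S : Set T) (hS : ∀ F : Finset T, (F : Set T) ⊆ S → P F ⊆ S)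
    (x : T → unitInterval) (hx : x ∈ K) : S.indicator x ∈ K := by
  classical
  subst hK
  rw [mem_closure_iff]
  intro o ho hxo
  obtain ⟨F, v, hv, hsub⟩ := isOpen_pi_iff.1 ho _ hxo
  obtain ⟨q, hq, hq1, hq2⟩ := hP (F.filter (· ∈ S)) x hx v (by
    intro t ht
    rw [Finset.mem_filter] at ht
    have := hv t ht.1
    rwa [indicator_of_mem ht.2] at this)
  refine ⟨q, hsub ?_, hq⟩
  intro t ht
  by_cases htS : t ∈ S
  · exact hq2 t (Finset.mem_filter.2 ⟨ht, htS⟩)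
  · have h0 : q t = 0 := by
      by_contra hne
      refine htS (hS (F.filter (· ∈ S)) ?_ (hq1 t hne))
      intro s hs
      exact (Finset.mem_filter.1 hs).2
    have := (hv t ht).2
    rw [indicator_of_notMem htS] at this
    rwa [h0]

lemma vald_retr {X : Type*} [TopologicalSpace X] [CompactSpace X]
    {Y : Type*} [TopologicalSpace Y] [CompactSpace Y]
    {T : Type*} (h : X → T → unitInterval) (hh : IsValdiviaEmbedding h)
    (f : X → Y) (hf : Continuous f) (g : Y → X) (hg : Continuous g) (hfg : f ∘ g = id)
    {I : Type*} (u : I → Y → unitInterval) (hu : ∀ i, Continuous (u i))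
    (hsep : ∀ y y', (∀ i, u i y = u i y') → y = y') :
    ∃ Ψ : Finset (T ⊕ I) → Set (T ⊕ I), (∀ F, (Ψ F).Countable) ∧
      ∀ Z, VCl Ψ Z → ∃ R : Y → Y, Continuous R ∧
        (∀ y, ∀ i, Sum.inr i ∈ Z → u i (R y) = u i y) ∧
        (∀ y y', (∀ i, Sum.inr i ∈ Z → u i y = u i y') → R y = R y') := by
  classical
  obtain ⟨hemb, hcl⟩ := hh
  have hhc : ∀ t, Continuous fun x => h x t := fun t => (continuous_apply t).comp hemb.continuous
  have hN := fun i => vald_countable_dep (fun t x => h x t) hhc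
    (fun x y hxy => hemb.injective (funext hxy)) (fun x => u i (f x)) ((hu i).comp hf)
  choose N hNc hN using hN
  have hM := fun t => vald_countable_dep u hu hsep (fun y => h (g y) t) ((hhc t).comp hg)
  choose M hMc hM using hM
  have hP := fun F => vald_good_op (Set.range h ∩ SigmaProd T) F inter_subset_right
  choose P hPc hP using hP
  refine ⟨fun F => Sum.inr '' (⋃ t ∈ F.toLeft, M t) ∪
    Sum.inl '' (P F.toLeft ∪ ⋃ i ∈ F.toRight, N i), ?_, ?_⟩
  · intro F
    refine ((Countable.biUnion F.toLeft.countable_toSet fun t _ => hMc t).image _).union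
      (((hPc _).union (Countable.biUnion F.toRight.countable_toSet fun t _ => hNc t)).image _)
  intro Z hZ
  have hZM : ∀ t, Sum.inl t ∈ Z → ∀ i ∈ M t, Sum.inr i ∈ Z := by
    intro t ht i hi
    apply hZ {Sum.inl t} (by simpa using ht)
    left
    refine ⟨i, ?_, rfl⟩
    simp only [mem_iUnion]
    exact ⟨t, by simp, hi⟩
  have hZN : ∀ i, Sum.inr i ∈ Z → ∀ t ∈ N i, Sum.inl t ∈ Z := by
    intro i hi t ht
    apply hZ {Sum.inr i} (by simpa using hi)
    right
    refine ⟨t, Or.inr ?_, rfl⟩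
    simp only [mem_iUnion]
    exact ⟨i, by simp, ht⟩
  let S : Set T := Sum.inl ⁻¹' Z
  have hZP : ∀ F : Finset T, (F : Set T) ⊆ S → P F ⊆ S := by
    intro F hF t ht
    apply hZ (F.map ⟨Sum.inl, Sum.inl_injective⟩)
    · intro w hw
      simp only [Finset.coe_map, Function.Embedding.coeFn_mk, mem_image] at hw
      obtain ⟨s, hs, rfl⟩ := hw
      exact hF hs
    · right
      refine ⟨t, Or.inl ?_, rfl⟩
      have : (F.map ⟨Sum.inl, Sum.inl_injective⟩ : Finset (T ⊕ I)).toLeft = F := by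
        ext s; simp
      rw [this]
      exact ht
  have hgood : ∀ x : X, ∃ x' : X, h x' = S.indicator (h x) := by
    intro x
    exact vald_good _ _ hcl P hP S hZP (h x) ⟨x, rfl⟩
  choose ρ hρ using hgood
  have hρc : Continuous ρ := by
    rw [hemb.continuous_iff]
    have : h ∘ ρ = fun x => S.indicator (h x) := funext hρ
    rw [this]
    refine continuous_pi fun t => ?_
    by_cases ht : t ∈ S
    · simpa only [indicator_of_mem ht] using hhc t
    · simpa only [indicator_of_notMem ht] using continuous_const
  refine ⟨f ∘ ρ ∘ g, hf.comp (hρc.comp hg), ?_, ?_⟩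
  · intro y i hi
    have h1 : u i (f (ρ (g y))) = u i (f (g y)) := by
      apply hN i
      intro t ht
      rw [hρ, indicator_of_mem (show t ∈ S from hZN i hi t ht)]
    have h2 : f (g y) = y := congrFun hfg y
    rw [h2] at h1
    exact h1
  · intro y y' hyy
    have : ρ (g y) = ρ (g y') := by
      apply hemb.injective
      rw [hρ, hρ]
      funext t
      by_cases ht : t ∈ S
      · rw [indicator_of_mem ht, indicator_of_mem ht]
        exact hM t y y' fun i hi => hyy i (hZM t ht i hi)
      · rw [indicator_of_notMem ht, indicator_of_notMem ht]
    simp [this]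

lemma vald_core {Y : Type v} [TopologicalSpace Y] [CompactSpace Y] [T2Space Y]
    {I : Type v} [LinearOrder I] [WellFoundedLT I] [Nonempty I]
    (hI : ∀ i : I, (Iic i).Countable)
    (u : I → Y → unitInterval) (hu : ∀ i, Continuous (u i))
    (hsep : ∀ y y', (∀ i, u i y = u i y') → y = y')
    (B : I → Set I) (hBc : ∀ i, (B i).Countable) (hB : ∀ i, Iic i ⊆ B i)
    (R : I → Y → Y) (hR : ∀ i, Continuous (R i))
    (h1 : ∀ ξ y, ∀ η < ξ, ∀ i ∈ B η, u i (R ξ y) = u i y)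
    (h2 : ∀ ξ y y', (∀ η < ξ, ∀ i ∈ B η, u i y = u i y') → R ξ y = R ξ y') :
    IsValdivia Y := by
  classical
  -- points that are eventually fixed
  have hD : ∀ (y₀ : Y) (γ : I), ∃ z : Y, (∀ i ∈ B γ, u i z = u i y₀) ∧
      ∀ η, γ < η → ∀ i ∈ B η, u i (R η z) = u i z := by
    intro y₀ γ
    let K : I → Set Y := fun ξ => {z | (∀ i ∈ B γ, u i z = u i y₀) ∧
      ∀ η, γ < η → η ≤ ξ → ∀ i ∈ B η, u i (R η z) = u i z}
    have hKc : ∀ ξ, IsClosed (K ξ) := by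
      intro ξ
      have : K ξ = (⋂ i ∈ B γ, {z | u i z = u i y₀}) ∩
          ⋂ η, ⋂ (_ : γ < η), ⋂ (_ : η ≤ ξ), ⋂ i ∈ B η, {z | u i (R η z) = u i z} := by
        ext z
        simp only [K, mem_inter_iff, mem_iInter]
        rfl
      rw [this]
      refine IsClosed.inter ?_ ?_
      · exact isClosed_biInter fun i _ => isClosed_eq (hu i) continuous_const
      · exact isClosed_iInter fun η => isClosed_iInter fun _ => isClosed_iInter fun _ =>
          isClosed_biInter fun i _ => isClosed_eq ((hu i).comp (hR η)) (hu i)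
    have hKm : ∀ ξ ξ', ξ ≤ ξ' → K ξ' ⊆ K ξ := fun ξ ξ' hle z hz =>
      ⟨hz.1, fun η h3 h4 => hz.2 η h3 (h4.trans hle)⟩
    have hlim : ∀ L : Set I, (∀ ξ ∈ L, (K ξ).Nonempty) → L.Nonempty →
        ∃ z, ∀ ξ ∈ L, z ∈ K ξ := by
      intro L hL hLn
      haveI : Nonempty L := hLn.to_subtype
      obtain ⟨z, hz⟩ := IsCompact.nonempty_iInter_of_directed_nonempty_isCompact_isClosed
        (fun ξ : L => K ξ) (by
          intro a b
          rcases le_total a b with hab | hab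
          · exact ⟨b, hKm _ _ hab, subset_rfl⟩
          · exact ⟨a, subset_rfl, hKm _ _ hab⟩)
        (fun ξ => hL ξ ξ.2) (fun ξ => (hKc ξ).isCompact) (fun ξ => hKc ξ)
      exact ⟨z, fun ξ hξ => mem_iInter.1 hz ⟨ξ, hξ⟩⟩
    have hne : ∀ ξ, (K ξ).Nonempty := by
      intro ξ
      induction ξ using WellFoundedLT.induction with
      | ind ξ ih =>
      by_cases hξ : ξ ≤ γ
      · exact ⟨y₀, fun _ _ => rfl, fun η h3 h4 => absurd (h3.trans_le h4) (not_lt.2 hξ)⟩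
      push Not at hξ
      obtain ⟨z, hz⟩ := hlim (Iio ξ) (fun η hη => ih η hη) ⟨γ, hξ⟩
      refine ⟨R ξ z, ?_, ?_⟩
      · intro i hi
        rw [h1 ξ z γ hξ i hi]
        exact (hz γ hξ).1 i hi
      · intro η hγη hηξ i hi
        have hRη : R η (R ξ z) = R η z :=
          h2 η _ _ fun ζ hζ j hj => h1 ξ z ζ (hζ.trans_le hηξ) j hj
        rw [hRη]
        rcases hηξ.lt_or_eq with hlt | rfl
        · rw [h1 ξ z η hlt i hi]
          exact (hz η hlt).2 η hγη le_rfl i hi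
        · rfl
    obtain ⟨z, hz⟩ := hlim univ (fun ξ _ => hne ξ) univ_nonempty
    exact ⟨z, (hz γ trivial).1, fun η hη => (hz η trivial).2 η hη le_rfl⟩
  let pr : ℝ → unitInterval := Set.projIcc 0 1 zero_le_one
  have hprc : Continuous pr := continuous_projIcc
  have hpr0 : pr 0 = 0 := by
    apply Subtype.ext; simp [pr, Set.coe_projIcc]
  have hprinj : ∀ a a' b : unitInterval, pr ((a:ℝ) - b) = pr ((a':ℝ) - b) →
      pr ((b:ℝ) - a) = pr ((b:ℝ) - a') → a = a' := by
    intro a a' b e1 e2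
    have e1' := congrArg Subtype.val e1
    have e2' := congrArg Subtype.val e2
    simp only [pr, Set.coe_projIcc] at e1' e2'
    have := a.2.1; have := a.2.2; have := a'.2.1; have := a'.2.2; have := b.2.1; have := b.2.2
    apply Subtype.ext
    rw [min_eq_right (by linarith), min_eq_right (by linarith)] at e1' e2'
    rcases le_total (a:ℝ) b with q1 | q1 <;> rcases le_total (a':ℝ) b with q2 | q2 <;>
      grind
  let H : Y → (I × I × Bool) → unitInterval := fun y t =>
    if t.2.1 ∈ B t.1 then
      (if t.2.2 then pr ((u t.2.1 y : ℝ) - u t.2.1 (R t.1 y))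
        else pr ((u t.2.1 (R t.1 y) : ℝ) - u t.2.1 y))
    else 0
  have hHc : Continuous H := by
    refine continuous_pi fun t => ?_
    have c1 : Continuous fun y => (u t.2.1 y : ℝ) := continuous_subtype_val.comp (hu _)
    have c2 : Continuous fun y => (u t.2.1 (R t.1 y) : ℝ) := c1.comp (hR _)
    simp only [H]
    split_ifs
    · exact hprc.comp (c1.sub c2)
    · exact hprc.comp (c2.sub c1)
    · exact continuous_const
  have hHi : Function.Injective H := by
    intro y y' hyy
    have key : ∀ ξ, ∀ i ∈ B ξ, u i y = u i y' := by
      intro ξ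
      induction ξ using WellFoundedLT.induction with
      | ind ξ ih =>
      intro i hi
      have hRR := h2 ξ y y' ih
      have e1 := congrFun hyy (ξ, i, true)
      have e2 := congrFun hyy (ξ, i, false)
      simp only [H, hi, if_true, hRR] at e1 e2
      exact hprinj _ _ _ e1 (by simpa using e2)
    exact hsep y y' fun i => key i i (hB i (mem_Iic.2 le_rfl))
  have hemb : IsEmbedding H := (hHc.isClosedEmbedding hHi).isEmbedding
  refine ⟨I × I × Bool, H, hemb, ?_⟩
  apply subset_antisymm
  · rintro _ ⟨y₀, rfl⟩
    choose z hz1 hz2 using hD y₀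
    have hconv : Tendsto z atTop (𝓝 y₀) := by
      have hue : IsEmbedding (fun y i => u i y) :=
        ((continuous_pi hu).isClosedEmbedding
          (fun y y' hyy => hsep y y' (congrFun hyy))).isEmbedding
      rw [hue.tendsto_nhds_iff, tendsto_pi_nhds]
      intro i
      refine tendsto_const_nhds.congr' ?_
      filter_upwards [eventually_ge_atTop i] with γ hγ
      exact (hz1 γ i (hB γ hγ)).symm
    refine mem_closure_of_tendsto ((hHc.tendsto y₀).comp hconv) (Eventually.of_forall fun γ => ?_)
    refine ⟨⟨z γ, rfl⟩, ?_⟩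
    have hcnt : (⋃ ξ ∈ Iic γ, (fun p : I × Bool => (ξ, p)) '' (B ξ ×ˢ univ)).Countable :=
      (hI γ).biUnion fun ξ _ => ((hBc ξ).prod countable_univ).image _
    refine hcnt.mono ?_
    rintro ⟨ξ, i, b⟩ ht
    have ht : H (z γ) (ξ, i, b) ≠ 0 := ht
    have hi : i ∈ B ξ := by
      by_contra hi
      exact ht (by simp [H, hi])
    have hξ : ξ ≤ γ := by
      by_contra hξ
      push Not at hξ
      apply ht
      simp [H, hi, hz2 γ ξ hξ i hi, hpr0]
    simp only [mem_iUnion]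
    exact ⟨ξ, hξ, (i, b), ⟨hi, trivial⟩, rfl⟩
  · exact closure_minimal inter_subset_left (isCompact_range hHc).isClosed

lemma vald_weight {Y : Type v} [TopologicalSpace Y] [CompactSpace Y] [T2Space Y]
    (hw : tweight Y ≤ Cardinal.aleph 1) :
    ∃ u : (Cardinal.aleph.{v} 1).ord.ToType → Y → unitInterval, (∀ i, Continuous (u i)) ∧
      ∀ y y', (∀ i, u i y = u i y') → y = y' := by
  classical
  obtain ⟨B, hB, hBc⟩ : tweight Y ∈ {c | ∃ B : Set (Set Y),
      TopologicalSpace.IsTopologicalBasis B ∧ Cardinal.mk ↥B = c} :=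
    csInf_mem ⟨_, _, TopologicalSpace.isTopologicalBasis_opens, rfl⟩
  have hcard : Cardinal.mk (B × B) ≤ Cardinal.mk (Cardinal.aleph.{v} 1).ord.ToType := by
    rw [Cardinal.mk_ord_toType, Cardinal.mk_prod, Cardinal.lift_id, hBc]
    exact (mul_le_mul' hw hw).trans (Cardinal.mul_eq_self (Cardinal.aleph0_le_aleph 1)).le
  obtain ⟨e⟩ := hcard
  have hur : ∀ p : B × B, ∃ φ : Y → unitInterval, Continuous φ ∧
      (Disjoint (closure (p.1 : Set Y)) (closure (p.2 : Set Y)) →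
        (∀ y ∈ (p.1 : Set Y), φ y = 0) ∧ ∀ y ∈ (p.2 : Set Y), φ y = 1) := by
    intro p
    by_cases hd : Disjoint (closure (p.1 : Set Y)) (closure (p.2 : Set Y))
    · obtain ⟨φ, h0, h1, h01⟩ := exists_continuous_zero_one_of_isClosed
        isClosed_closure isClosed_closure hd
      refine ⟨fun y => ⟨φ y, h01 y⟩, by fun_prop, fun _ => ⟨fun y hy => ?_, fun y hy => ?_⟩⟩
      · exact Subtype.ext (h0 (subset_closure hy))
      · exact Subtype.ext (h1 (subset_closure hy))
    · exact ⟨fun _ => 0, continuous_const, fun h => absurd h hd⟩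
  choose φ hφc hφ using hur
  refine ⟨Function.extend e φ (fun _ _ => 0), ?_, ?_⟩
  · intro i
    by_cases hi : ∃ p, e p = i
    · obtain ⟨p, rfl⟩ := hi
      rw [e.injective.extend_apply]
      exact hφc p
    · rw [Function.extend_apply' _ _ _ hi]
      exact continuous_const
  · intro y y' hyy
    by_contra hne
    obtain ⟨U, hyU, hU, V, hyV, hV, hd⟩ := exists_open_nhds_disjoint_closure hne
    obtain ⟨b, hb, hyb, hbU⟩ := hB.exists_subset_of_mem_open hyU hU
    obtain ⟨c, hc, hyc, hcV⟩ := hB.exists_subset_of_mem_open hyV hV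
    have := hyy (e (⟨b, hb⟩, ⟨c, hc⟩))
    rw [e.injective.extend_apply] at this
    have hp := hφ (⟨b, hb⟩, ⟨c, hc⟩) (hd.mono (closure_mono hbU) (closure_mono hcV))
    rw [hp.1 y hyb, hp.2 y' hyc] at this
    exact zero_ne_one this

/-- if `X` is Valdivia compact and `f : X → Y` is a retraction onto a
compact Hausdorff space `Y` of weight at most `ℵ₁`, then `Y` is Valdivia compact. -/
theorem statement13 {X : Type u} [TopologicalSpace X] [CompactSpace X] [T2Space X]
    {Y : Type v} [TopologicalSpace Y] [CompactSpace Y] [T2Space Y]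
    (hX : IsValdivia X)
    (f : X → Y) (hf : Continuous f) (hfs : Function.Surjective f)
    (g : Y → X) (hg : Continuous g) (hfg : f ∘ g = id)
    (hw : tweight Y ≤ Cardinal.aleph 1) :
    IsValdivia Y := by
  classical
  obtain ⟨T, h, hh⟩ := hX
  obtain ⟨u, hu, hsep⟩ := vald_weight hw
  obtain ⟨Ψ, hΨc, hΨ⟩ := vald_retr h hh f hf g hg hfg u hu hsep
  obtain ⟨cl, hcl1, hcl2, hcl3, hcl4⟩ := vcl_closure Ψ hΨc
  have hI : ∀ i : (Cardinal.aleph.{v} 1).ord.ToType, (Iic i).Countable := by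
    intro i
    have h1 : Cardinal.mk (Iio i) < Cardinal.aleph 1 := by simpa using Cardinal.mk_Iio_lt i
    have h2 : (Iio i).Countable := by
      have h3 := h1.trans_eq Cardinal.succ_aleph0.symm
      rwa [Order.lt_succ_iff, Cardinal.le_aleph0_iff_set_countable] at h3
    rw [← Iio_insert]
    exact h2.insert i
  haveI : Nonempty (Cardinal.aleph.{v} 1).ord.ToType := by
    rw [← Cardinal.mk_ne_zero_iff, Cardinal.mk_ord_toType]
    exact (Cardinal.aleph_pos 1).ne'
  let C : (Cardinal.aleph.{v} 1).ord.ToType → Set (T ⊕ (Cardinal.aleph.{v} 1).ord.ToType) :=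
    fun ξ => cl (Sum.inr '' Iic ξ)
  have hCm : Monotone C := fun a b hab => hcl3 (image_mono (Iic_subset_Iic.2 hab))
  have hRex : ∀ ξ, ∃ R : Y → Y, Continuous R ∧
      (∀ y, ∀ η < ξ, ∀ i ∈ Sum.inr ⁻¹' C η, u i (R y) = u i y) ∧
      (∀ y y', (∀ η < ξ, ∀ i ∈ Sum.inr ⁻¹' C η, u i y = u i y') → R y = R y') := by
    intro ξ
    by_cases hne : (Iio ξ).Nonempty
    · haveI : Nonempty (Iio ξ) := hne.to_subtype
      obtain ⟨R, hR, hR1, hR2⟩ := hΨ (⋃ η : Iio ξ, C η) (VCl.iUnion (fun η => hcl2 _)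
        (Monotone.directed_le fun a b hab => hCm hab))
      refine ⟨R, hR, fun y η hη i hi => hR1 y i (mem_iUnion.2 ⟨⟨η, hη⟩, hi⟩), ?_⟩
      intro y y' hyy
      refine hR2 y y' fun i hi => ?_
      obtain ⟨η, hη⟩ := mem_iUnion.1 hi
      exact hyy η η.2 i hη
    · have hno : ∀ η, ¬ η < ξ := fun η hη => hne ⟨η, hη⟩
      by_cases hY : Nonempty Y
      · obtain ⟨y₀⟩ := hY
        exact ⟨fun _ => y₀, continuous_const, fun y η hη => absurd hη (hno η), fun _ _ _ => rfl⟩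
      · exact ⟨id, continuous_id, fun y => absurd ⟨y⟩ hY, fun y => absurd ⟨y⟩ hY⟩
  choose R hR hR1 hR2 using hRex
  refine vald_core hI u hu hsep (fun ξ => Sum.inr ⁻¹' C ξ) ?_ ?_ R hR hR1 hR2
  · intro ξ
    exact (hcl4 _ ((hI ξ).image _)).preimage Sum.inr_injective
  · intro ξ i hi
    exact hcl1 _ ⟨i, hi, rfl⟩
end

section
/- Let X be a Valdivia compact space and let f : X → Y be a continuous open surjection onto a zero-dimensional (totally disconnected) compact Hausdorff space Y of weight at most ℵ₁. Then Y is Valdivia compact. -/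
open Set Filter Topology

universe u v

lemma cl_exists {P : Type*} (Op : Finset P → Set P) (hOp : ∀ s, (Op s).Countable) :
    ∃ cl : Set P → Set P, (∀ A, A ⊆ cl A) ∧ (∀ A B, A ⊆ B → cl A ⊆ cl B) ∧
      (∀ A (s : Finset P), ↑s ⊆ cl A → Op s ⊆ cl A) ∧
      (∀ A, A.Countable → (cl A).Countable) ∧
      (∀ A, ∀ x ∈ cl A, ∃ s : Finset P, ↑s ⊆ A ∧ x ∈ cl ↑s) := by
  classical
  let cl : Set P → Set P := fun A => {x | ∀ N : Set P, A ⊆ N →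
    (∀ s : Finset P, ↑s ⊆ N → Op s ⊆ N) → x ∈ N}
  have h1 : ∀ A, A ⊆ cl A := fun A x hx N hN _ => hN hx
  have h2 : ∀ A B, A ⊆ B → cl A ⊆ cl B := fun A B h x hx N hN hc => hx N (h.trans hN) hc
  have h3 : ∀ A (s : Finset P), ↑s ⊆ cl A → Op s ⊆ cl A := by
    intro A s hs x hx N hN hc
    exact hc s (fun y hy => hs hy N hN hc) hx
  refine ⟨cl, h1, h2, h3, ?_, ?_⟩
  · intro A hA
    let step : Set P → Set P := fun N => N ∪ ⋃ s ∈ {s : Finset P | ↑s ⊆ N}, Op s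
    let It : ℕ → Set P := fun n => step^[n] A
    have hsucc : ∀ n, It (n+1) = step (It n) := fun n => Function.iterate_succ_apply' _ _ _
    have hcount : ∀ n, (It n).Countable := by
      intro n
      induction n with
      | zero => exact hA
      | succ n ih =>
        rw [hsucc]
        refine ih.union (Set.Countable.biUnion ?_ (fun s _ => hOp s))
        refine ((Set.countable_ofPred_finite_subset ih).preimage
          (Finset.coe_injective (α := P))).mono ?_
        intro s hs
        exact ⟨s.finite_toSet, hs⟩
    have hmono : Monotone It := monotone_nat_of_le_succ fun n => by
      rw [hsucc]; exact subset_union_left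
    refine (Set.countable_iUnion hcount).mono ?_
    intro x hx
    refine hx _ (subset_iUnion It 0) ?_
    intro s hs
    have : ∃ n, ↑s ⊆ It n := by
      exact hmono.directed_le.exists_mem_subset_of_finset_subset_biUnion hs
    obtain ⟨n, hn⟩ := this
    refine Subset.trans ?_ (subset_iUnion It (n+1))
    rw [hsucc]
    intro y hy
    exact Or.inr (mem_biUnion (show s ∈ {s : Finset P | ↑s ⊆ It n} from hn) hy)
  · intro A x hx
    refine hx {x | ∃ s : Finset P, ↑s ⊆ A ∧ x ∈ cl ↑s} ?_ ?_
    · intro y hy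
      exact ⟨{y}, by simpa using hy, h1 _ (by simp)⟩
    · intro s hs y hy
      choose! g hg using hs
      refine ⟨s.biUnion g, ?_, ?_⟩
      · intro z hz
        simp only [Finset.coe_biUnion, mem_iUnion] at hz
        obtain ⟨i, hi, hz⟩ := hz
        exact (hg hi).1 hz
      · refine h3 _ s ?_ hy
        intro z hz
        refine h2 _ _ ?_ (hg hz).2
        intro w hw
        simp only [Finset.coe_biUnion, mem_iUnion]
        exact ⟨z, hz, hw⟩

/-- locally constant selection -/
lemma loc_sel {Z α : Type*} [TopologicalSpace Z] [SecondCountableTopology Z]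
    (hb : TopologicalSpace.IsTopologicalBasis {s : Set Z | IsClopen s})
    (R : Z → α → Prop) (hR : ∀ z, ∃ a, ∀ᶠ z' in 𝓝 z, R z' a) :
    ∃ g : Z → α, (∀ z, R z (g z)) ∧ IsLocallyConstant g := by
  classical
  rcases isEmpty_or_nonempty Z with hZ | hZ
  · exact ⟨fun z => (hZ.false z).elim, fun z => (hZ.false z).elim, fun s => by
      convert isOpen_empty; ext z; exact (hZ.false z).elim⟩
  choose a ha using hR
  have : ∀ z, ∃ U : Set Z, IsClopen U ∧ z ∈ U ∧ ∀ z' ∈ U, R z' (a z) := by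
    intro z
    obtain ⟨U, hU, hz, hs⟩ := hb.mem_nhds_iff.1 (ha z)
    exact ⟨U, hU, hz, hs⟩
  choose U hU hzU hUR using this
  obtain ⟨t, htc, ht⟩ := TopologicalSpace.countable_cover_nhds (f := U)
    (fun z => (hU z).isOpen.mem_nhds (hzU z))
  have htne : t.Nonempty := by
    obtain ⟨z⟩ := hZ
    have : z ∈ ⋃ x ∈ t, U x := ht ▸ mem_univ z
    simp only [mem_iUnion] at this
    obtain ⟨x, hx, _⟩ := this
    exact ⟨x, hx⟩
  obtain ⟨e, he⟩ := htc.exists_eq_range htne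
  have hcov : ∀ z, ∃ n, z ∈ U (e n) := by
    intro z
    have : z ∈ ⋃ x ∈ t, U x := ht ▸ mem_univ z
    simpa [he] using this
  refine ⟨fun z => a (e (Nat.find (hcov z))), fun z => hUR _ _ (Nat.find_spec (hcov z)), ?_⟩
  have hN : IsLocallyConstant (fun z => Nat.find (hcov z)) := by
    rw [IsLocallyConstant.iff_eventually_eq]
    intro z
    set n := Nat.find (hcov z) with hn
    have h1 : ∀ᶠ y in 𝓝 z, y ∈ U (e n) :=
      (hU _).isOpen.mem_nhds (Nat.find_spec (hcov z))
    have h2 : ∀ᶠ y in 𝓝 z, ∀ m ∈ Finset.range n, y ∉ U (e m) := by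
      rw [Filter.eventually_all_finset]
      intro m hm
      exact (hU _).compl.isOpen.mem_nhds (Nat.find_min (hcov z) (Finset.mem_range.1 hm))
    filter_upwards [h1, h2] with y hy1 hy2
    rw [Nat.find_eq_iff]
    exact ⟨hy1, fun m hm => hy2 m (Finset.mem_range.2 hm)⟩
  exact hN.comp (fun n => a (e n))

/-- zero-dimensional Michael selection -/
lemma michael {Z K : Type*} [TopologicalSpace Z] [SecondCountableTopology Z]
    (hb : TopologicalSpace.IsTopologicalBasis {s : Set Z | IsClopen s})
    [MetricSpace K] [CompleteSpace K] (Φ : Z → Set K)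
    (hne : ∀ z, (Φ z).Nonempty) (hcl : ∀ z, IsClosed (Φ z))
    (hlsc : ∀ W : Set K, IsOpen W → IsOpen {z | (Φ z ∩ W).Nonempty}) :
    ∃ s : Z → K, Continuous s ∧ ∀ z, s z ∈ Φ z := by
  classical
  let A : ℕ → Type _ := fun n =>
    {g : Z → K // IsLocallyConstant g ∧ ∀ z, (Φ z ∩ Metric.ball (g z) ((1/2)^n)).Nonempty}
  have h0 : Nonempty (A 0) := by
    obtain ⟨g, hg, hl⟩ := loc_sel hb
      (fun z a => (Φ z ∩ Metric.ball a ((1/2)^0)).Nonempty) (by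
        intro z
        obtain ⟨x, hx⟩ := hne z
        exact ⟨x, (hlsc _ Metric.isOpen_ball).mem_nhds
          ⟨x, hx, Metric.mem_ball_self (by positivity)⟩⟩)
    exact ⟨⟨g, hl, hg⟩⟩
  have hstep : ∀ n (g : A n), ∃ g' : A (n+1), ∀ z, dist (g.1 z) (g'.1 z) ≤ 1 * (1/2)^n := by
    intro n g
    obtain ⟨g', hg, hl⟩ := loc_sel hb
      (fun z a => dist (g.1 z) a ≤ 1 * (1/2)^n ∧
        (Φ z ∩ Metric.ball a ((1/2)^(n+1))).Nonempty) (by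
        intro z
        obtain ⟨x, hx, hxb⟩ := g.2.2 z
        refine ⟨x, ?_⟩
        filter_upwards [(hlsc _ Metric.isOpen_ball).mem_nhds
          ⟨x, hx, Metric.mem_ball_self (by positivity : (0:ℝ) < (1/2)^(n+1))⟩,
          (IsLocallyConstant.iff_eventually_eq _).1 g.2.1 z] with y hy1 hy2
        refine ⟨?_, hy1⟩
        rw [hy2, dist_comm, one_mul]
        exact (Metric.mem_ball.1 hxb).le)
    exact ⟨⟨g', hl, fun z => (hg z).2⟩, fun z => (hg z).1⟩
  choose nxt hnxt using hstep
  obtain ⟨g0⟩ := h0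
  let G : (n : ℕ) → A n := fun n => Nat.rec g0 (fun n g => nxt n g) n
  have hG : ∀ n z, dist ((G n).1 z) ((G (n+1)).1 z) ≤ 1 * (1/2)^n := fun n z => hnxt n (G n) z
  have hc : ∀ z, ∃ l, Tendsto (fun n => (G n).1 z) atTop (𝓝 l) := fun z =>
    cauchySeq_tendsto_of_complete
      (cauchySeq_of_le_geometric (1/2) 1 (by norm_num) (fun n => hG n z))
  choose s hs using hc
  have hd : ∀ n z, dist ((G n).1 z) (s z) ≤ 1 * (1/2)^n / (1 - 1/2) := fun n z =>
    dist_le_of_le_geometric_of_tendsto (1/2) 1 (by norm_num) (fun n => hG n z) (hs z) n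
  have hlim : Tendsto (fun n : ℕ => (1:ℝ) * (1/2)^n / (1 - 1/2)) atTop (𝓝 0) := by
    have := (tendsto_pow_atTop_nhds_zero_of_lt_one (r := (1/2:ℝ)) (by norm_num) (by norm_num))
    simpa using (this.const_mul 1).div_const (1 - 1/2)
  refine ⟨s, ?_, ?_⟩
  · have hu : TendstoUniformly (fun n z => (G n).1 z) s atTop := by
      rw [Metric.tendstoUniformly_iff]
      intro ε hε
      filter_upwards [hlim.eventually (gt_mem_nhds hε)] with n hn z
      rw [dist_comm]
      exact (hd n z).trans_lt hn
    exact hu.continuous (Filter.Frequently.of_forall fun n => (G n).2.1.continuous)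
  · intro z
    choose x hx hxb using fun n => (G n).2.2 z
    refine (hcl z).mem_of_tendsto (f := x) (b := atTop) ?_ (Eventually.of_forall hx)
    refine tendsto_of_tendsto_of_dist (hs z) ?_
    refine squeeze_zero (fun _ => dist_nonneg) (fun n => ?_)
      (tendsto_pow_atTop_nhds_zero_of_lt_one (r := (1/2:ℝ)) (by norm_num) (by norm_num))
    rw [dist_comm]
    exact (Metric.mem_ball.1 (hxb n)).le

lemma valdivia_of_family {Y : Type v} [TopologicalSpace Y] [CompactSpace Y] [T2Space Y]
    (G : Set (TopologicalSpace.Clopens Y))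
    (hsep : ∀ y y', (∀ U ∈ G, y ∈ U ↔ y' ∈ U) → y = y')
    (hdense : Dense {y : Y | {U | U ∈ G ∧ y ∈ U}.Countable}) : IsValdivia Y := by
  classical
  let h : Y → G → unitInterval := fun y U => if y ∈ U.1 then 1 else 0
  have hc : Continuous h := by
    refine continuous_pi fun U => ?_
    refine IsLocallyConstant.continuous ?_
    have : IsLocallyConstant (fun y => y ∈ U.1) := by
      rw [IsLocallyConstant.iff_eventually_eq]
      intro y
      by_cases hy : y ∈ U.1
      · filter_upwards [U.1.isClopen.isOpen.mem_nhds hy] with z hz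
        simp only [hy, eq_iff_iff, iff_true]; exact hz
      · filter_upwards [U.1.isClopen.compl.isOpen.mem_nhds hy] with z hz
        simp only [hy, eq_iff_iff, iff_false]; exact hz
    exact this.comp (fun p : Prop => if p then (1 : unitInterval) else 0)
  have hi : Function.Injective h := by
    intro y y' hyy
    refine hsep _ _ fun U hU => ?_
    have := congrFun hyy ⟨U, hU⟩
    simp only [h] at this
    by_cases h1 : y ∈ U <;> by_cases h2 : y' ∈ U <;> simp_all
  have he := hc.isClosedEmbedding hi
  refine ⟨G, h, he.isEmbedding, ?_⟩
  refine Subset.antisymm ?_ (closure_minimal inter_subset_left he.isClosed_range)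
  have h1 : range h ⊆ closure (h '' {y : Y | {U | U ∈ G ∧ y ∈ U}.Countable}) := by
    rintro _ ⟨y, rfl⟩
    exact image_closure_subset_closure_image hc ⟨y, hdense y, rfl⟩
  refine h1.trans (closure_mono ?_)
  rintro _ ⟨y, hy, rfl⟩
  refine ⟨⟨y, rfl⟩, ?_⟩
  refine (Set.Countable.preimage hy (Subtype.val_injective (p := (· ∈ G)))).mono ?_
  intro U hU
  refine ⟨U.2, ?_⟩
  by_contra hn
  exact hU (by simp only [h]; exact if_neg hn)

lemma exists_rank {C : Type v} (hC : Cardinal.mk C ≤ Cardinal.aleph 1) :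
    ∃ ρ : C → Ordinal.{v}, Function.Injective ρ ∧ ∀ a, {b | ρ b ≤ ρ a}.Countable := by
  obtain ⟨r, wo, hr⟩ := Cardinal.exists_ord_eq C
  refine ⟨Ordinal.typein r, Ordinal.typein_injective r, fun a => ?_⟩
  have h1 : {b | r b a}.Countable := by
    have h : Ordinal.typein r a < Cardinal.ord (Cardinal.mk C) := by
      rw [hr]; exact Ordinal.typein_lt_type r a
    rw [Cardinal.lt_ord, Ordinal.card_typein] at h
    have h' := h.trans_le hC
    rw [← Cardinal.succ_aleph0, Order.lt_succ_iff] at h'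
    exact Cardinal.le_aleph0_iff_set_countable.1 h'
  refine (h1.union (countable_singleton a)).mono ?_
  intro b hb
  rcases lt_or_eq_of_le (mem_ofPred_eq ▸ hb) with h | h
  · exact Or.inl ((Ordinal.typein_lt_typein r).1 h)
  · exact Or.inr (Ordinal.typein_injective r h)

lemma valdivia_of_closure {Y : Type v} [TopologicalSpace Y] [CompactSpace Y] [T2Space Y]
    [TotallyDisconnectedSpace Y]
    (hC : Cardinal.mk (TopologicalSpace.Clopens Y) ≤ Cardinal.aleph 1)
    (cl : Set (TopologicalSpace.Clopens Y) → Set (TopologicalSpace.Clopens Y))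
    (h1 : ∀ A, A ⊆ cl A) (h2 : ∀ A B, A ⊆ B → cl A ⊆ cl B)
    (h3 : ∀ A, ∀ x ∈ cl A, ∃ s : Finset (TopologicalSpace.Clopens Y), ↑s ⊆ A ∧ x ∈ cl ↑s)
    (h4 : ∀ A, A.Countable → (cl A).Countable)
    (h5 : ∀ A, ∀ U ∈ cl A, ∀ V ∈ cl A, U \ V ∈ cl A)
    (h6 : ∀ A, A.Countable → ∃ r : Y → Y, (∀ U ∈ cl A, ∀ y, r y ∈ U ↔ y ∈ U) ∧
      ∀ U : TopologicalSpace.Clopens Y, ∃ V ∈ cl A, ∀ y, r y ∈ U ↔ y ∈ V) :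
    IsValdivia Y := by
  classical
  obtain ⟨ρ, hρ, hρc⟩ := exists_rank hC
  let Lt : TopologicalSpace.Clopens Y → Set (TopologicalSpace.Clopens Y) :=
    fun a => cl {b | ρ b < ρ a}
  let Le : TopologicalSpace.Clopens Y → Set (TopologicalSpace.Clopens Y) :=
    fun a => cl {b | ρ b ≤ ρ a}
  have hLtLe : ∀ a, Lt a ⊆ Le a := fun a => h2 _ _ fun b (hb : ρ b < ρ a) => (le_of_lt hb : ρ b ≤ ρ a)
  have hLeLt : ∀ a b, ρ a < ρ b → Le a ⊆ Lt b := fun a b hab => h2 _ _ fun c hc =>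
    lt_of_le_of_lt hc hab
  have hself : ∀ a, a ∈ Le a := fun a => h1 _ (le_refl (ρ a))
  choose r hr1 hr2 using fun a => h6 {b | ρ b < ρ a} ((hρc a).mono fun b (hb : ρ b < ρ a) => (le_of_lt hb : ρ b ≤ ρ a))
  let V : TopologicalSpace.Clopens Y → Set (TopologicalSpace.Clopens Y) :=
    fun a => {U | U ∈ Le a ∧ ∀ y, r a y ∉ U}
  let G : Set (TopologicalSpace.Clopens Y) := cl ∅ ∪ ⋃ a, V a
  refine valdivia_of_family G ?_ ?_
  · intro y y' hyy
    have key : ∀ o : Ordinal, ∀ a, ρ a = o → ∀ U ∈ Le a, (y ∈ U ↔ y' ∈ U) := by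
      intro o
      induction o using WellFoundedLT.induction with
      | ind o ih =>
        rintro a rfl U hU
        obtain ⟨W, hW, hWr⟩ := hr2 a U
        have hWy : y ∈ W ↔ y' ∈ W := by
          obtain ⟨s, hs, hWs⟩ := h3 _ _ hW
          rcases s.eq_empty_or_nonempty with rfl | hne
          · exact hyy W (Or.inl (by simpa using hWs))
          · obtain ⟨b, hb, hmax⟩ := s.exists_max_image ρ hne
            exact ih (ρ b) (hs hb) b rfl W (h2 _ _ (fun c hc => hmax c hc) hWs)
        have hWW : ∀ z, r a z ∈ W ↔ z ∈ W := fun z => hr1 a W hW z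
        have e1 : U \ W ∈ V a := by
          refine ⟨h5 _ _ hU _ (hLtLe a hW), fun z hz => ?_⟩
          have hz1 : r a z ∈ U := hz.1
          have hz2 : r a z ∉ W := hz.2
          exact hz2 ((hWW z).2 ((hWr z).1 hz1))
        have e2 : W \ U ∈ V a := by
          refine ⟨h5 _ _ (hLtLe a hW) _ hU, fun z hz => ?_⟩
          have hz1 : r a z ∈ W := hz.1
          have hz2 : r a z ∉ U := hz.2
          exact hz2 ((hWr z).2 ((hWW z).1 hz1))
        have f1 : (y ∈ U ∧ y ∉ W) ↔ (y' ∈ U ∧ y' ∉ W) :=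
          hyy _ (Or.inr (mem_iUnion.2 ⟨a, e1⟩))
        have f2 : (y ∈ W ∧ y ∉ U) ↔ (y' ∈ W ∧ y' ∉ U) :=
          hyy _ (Or.inr (mem_iUnion.2 ⟨a, e2⟩))
        tauto
    by_contra hne
    obtain ⟨U, hU, hy, hy'⟩ := exists_isClopen_of_totally_separated hne
    exact hy' ((key _ ⟨U, hU⟩ rfl _ (hself _)).1 hy)
  · rw [isTopologicalBasis_isClopen.dense_iff]
    intro U0 hU0 hne
    let U : TopologicalSpace.Clopens Y := ⟨U0, hU0⟩
    let ι := {p : TopologicalSpace.Clopens Y × TopologicalSpace.Clopens Y //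
      ρ U < ρ p.1 ∧ p.2 ∈ V p.1}
    have hfin : ∀ u : Finset ι, (U0 ∩ ⋂ i ∈ u, ((i.1.2 : Set Y))ᶜ).Nonempty := by
      intro u
      induction u using Finset.induction_on_max_value (fun i : ι => ρ i.1.1) with
      | empty => simpa using hne
      | insert a s _ hmax ih =>
        obtain ⟨y, hyU, hy⟩ := ih
        refine ⟨r a.1.1 y, ?_, ?_⟩
        · exact (hr1 a.1.1 U (hLeLt _ _ a.2.1 (hself U)) y).2 hyU
        · simp only [Finset.mem_insert, mem_iInter]
          rintro i (rfl | hi)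
          · exact i.2.2.2 y
          · rcases lt_or_eq_of_le (hmax i hi) with hlt | heq
            · intro hm
              have := (hr1 a.1.1 i.1.2 (hLeLt _ _ hlt i.2.2.1) y).1 hm
              simp only [mem_iInter] at hy
              exact hy i hi this
            · rw [← hρ heq]
              exact i.2.2.2 y
    obtain ⟨y, hyU, hy⟩ := hU0.isClosed.isCompact.inter_iInter_nonempty _
      (fun i : ι => i.1.2.isClopen.compl.isClosed) hfin
    refine ⟨y, hyU, ?_⟩
    refine ((h4 ∅ countable_empty).union (h4 _ (hρc U))).mono ?_
    rintro W ⟨hW | hW, hyW⟩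
    · exact Or.inl hW
    · obtain ⟨a, ha⟩ := mem_iUnion.1 hW
      rcases lt_or_ge (ρ U) (ρ a) with hlt | hge
      · exact absurd hyW (mem_iInter.1 hy ⟨(a, W), hlt, ha⟩)
      · exact Or.inr (h2 _ _ (fun b hb => le_trans hb hge) ha.1)

lemma clopens_card {Y : Type v} [TopologicalSpace Y] [CompactSpace Y]
    (hw : tweight Y ≤ Cardinal.aleph 1) :
    Cardinal.mk (TopologicalSpace.Clopens Y) ≤ Cardinal.aleph 1 := by
  classical
  have hne : {c | ∃ B : Set (Set Y), TopologicalSpace.IsTopologicalBasis B ∧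
      Cardinal.mk ↥B = c}.Nonempty :=
    ⟨_, _, TopologicalSpace.isTopologicalBasis_opens, rfl⟩
  obtain ⟨B, hB, hBc⟩ := csInf_mem hne
  have hB1 : Cardinal.mk B ≤ Cardinal.aleph 1 := hBc.trans_le hw
  have hF : Cardinal.mk (Finset B) ≤ Cardinal.aleph 1 := by
    rcases finite_or_infinite B with h | h
    · exact (Cardinal.mk_le_aleph0).trans (Cardinal.aleph0_le_aleph 1)
    · rw [Cardinal.mk_finset_of_infinite]; exact hB1
  have : ∀ U : TopologicalSpace.Clopens Y, ∃ F : Finset B, (U : Set Y) = ⋃ b ∈ F, (b : Set Y) := by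
    intro U
    have hcov : (U : Set Y) ⊆ ⋃ b : {b : B // (b : Set Y) ⊆ U}, (b.1 : Set Y) := by
      intro y hy
      obtain ⟨b, hb, hyb, hbU⟩ := hB.exists_subset_of_mem_open hy U.isClopen.isOpen
      exact mem_iUnion.2 ⟨⟨⟨b, hb⟩, hbU⟩, hyb⟩
    obtain ⟨t, ht⟩ := U.isClopen.isClosed.isCompact.elim_finite_subcover _
      (fun b => hB.isOpen b.1.2) hcov
    refine ⟨t.image Subtype.val, Subset.antisymm (fun y hy => ?_) ?_⟩
    · have := ht hy
      simp only [mem_iUnion] at this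
      obtain ⟨b, hb, hyb⟩ := this
      exact mem_biUnion (Finset.mem_image_of_mem _ hb) hyb
    · refine iUnion₂_subset fun b hb => ?_
      obtain ⟨c, _, rfl⟩ := Finset.mem_image.1 hb
      exact c.2
  choose F hF' using this
  refine (Cardinal.mk_le_of_injective (f := F) ?_).trans hF
  intro U U' h
  apply SetLike.coe_injective
  rw [hF' U, hF' U', h]

lemma michaelB {Z K : Type*} (B : Set (Set Z)) (hBc : B.Countable) (huniv : univ ∈ B)
    (hinter : ∀ U ∈ B, ∀ V ∈ B, U ∩ V ∈ B) (hcompl : ∀ U ∈ B, Uᶜ ∈ B)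
    [MetricSpace K] [CompleteSpace K] (Φ : Z → Set K)
    (hne : ∀ z, (Φ z).Nonempty) (hcl : ∀ z, IsClosed (Φ z))
    (hlsc : ∀ W : Set K, IsOpen W → ∀ z, (Φ z ∩ W).Nonempty →
      ∃ C ∈ B, z ∈ C ∧ ∀ z' ∈ C, (Φ z' ∩ W).Nonempty) :
    ∃ s : Z → K, (∀ z, s z ∈ Φ z) ∧ ∀ W : Set K, IsOpen W → ∀ z, s z ∈ W →
      ∃ C ∈ B, z ∈ C ∧ ∀ z' ∈ C, s z' ∈ W := by
  let τ : TopologicalSpace Z := TopologicalSpace.generateFrom B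
  have hopen : ∀ U ∈ B, IsOpen U := fun U hU => TopologicalSpace.isOpen_generateFrom_of_mem hU
  have hbas : TopologicalSpace.IsTopologicalBasis B :=
    { exists_subset_inter := fun U hU V hV x hx => ⟨U ∩ V, hinter U hU V hV, hx, Subset.rfl⟩
      sUnion_eq := eq_univ_of_univ_subset (subset_sUnion_of_mem huniv)
      eq_generateFrom := rfl }
  have : SecondCountableTopology Z := hbas.secondCountableTopology hBc
  have hclop : TopologicalSpace.IsTopologicalBasis {s : Set Z | IsClopen s} := by
    refine TopologicalSpace.isTopologicalBasis_of_isOpen_of_nhds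
      (fun u (hu : IsClopen u) => hu.isOpen) ?_
    intro z O hz hO
    obtain ⟨U, hU, hzU, hUO⟩ := hbas.exists_subset_of_mem_open hz hO
    exact ⟨U, ⟨⟨hopen _ (hcompl U hU)⟩, hopen U hU⟩, hzU, hUO⟩
  obtain ⟨s, hs, hsΦ⟩ := michael hclop Φ hne hcl (by
    intro W hW
    rw [hbas.isOpen_iff]
    intro z hz
    obtain ⟨C, hC, hzC, h⟩ := hlsc W hW z hz
    exact ⟨C, hC, hzC, h⟩)
  refine ⟨s, hsΦ, ?_⟩
  intro W hW z hz
  obtain ⟨C, hC, hzC, h⟩ := hbas.exists_subset_of_mem_open (a := z) hz (hW.preimage hs)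
  exact ⟨C, hC, hzC, h⟩

abbrev QB : Type := ↥(TopologicalSpace.countableBasis unitInterval)

def bx {T : Type*} (e : Finset (T × QB)) : Set (T → unitInterval) :=
  {x | ∀ p ∈ e, x p.1 ∈ (p.2 : Set unitInterval)}

lemma qb_open (q : QB) : IsOpen (q : Set unitInterval) :=
  TopologicalSpace.isOpen_of_mem_countableBasis q.2

lemma bx_basis {T : Type*} {O : Set (T → unitInterval)} (hO : IsOpen O) {x : T → unitInterval}
    (hx : x ∈ O) : ∃ e : Finset (T × QB), x ∈ bx e ∧ bx e ⊆ O := by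
  classical
  obtain ⟨J, u, hu, hsub⟩ := isOpen_pi_iff.1 hO x hx
  have : ∀ a, ∃ q : QB, a ∈ J → x a ∈ (q : Set unitInterval) ∧ (q : Set unitInterval) ⊆ u a := by
    intro a
    by_cases ha : a ∈ J
    · obtain ⟨q, hq, hxq, hqu⟩ := (TopologicalSpace.isBasis_countableBasis
        unitInterval).exists_subset_of_mem_open (hu a ha).2 (hu a ha).1
      exact ⟨⟨q, hq⟩, fun _ => ⟨hxq, hqu⟩⟩
    · obtain ⟨q, hq, hxq, hqu⟩ := (TopologicalSpace.isBasis_countableBasis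
        unitInterval).exists_subset_of_mem_open (mem_univ (x a)) isOpen_univ
      exact ⟨⟨q, hq⟩, fun h => absurd h ha⟩
  choose q hq using this
  refine ⟨J.image fun a => (a, q a), ?_, ?_⟩
  · intro p hp
    obtain ⟨a, ha, rfl⟩ := Finset.mem_image.1 hp
    exact (hq a ha).1
  · intro z hz
    refine hsub fun a ha => (hq a ha).2 ?_
    exact hz (a, q a) (Finset.mem_image_of_mem _ ha)

lemma bx_open {T : Type*} (e : Finset (T × QB)) : IsOpen (bx e) := by
  have : bx e = ⋂ p ∈ e, (fun x : T → unitInterval => x p.1) ⁻¹' (p.2 : Set unitInterval) := by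
    ext x; simp [bx]
  rw [this]
  exact isOpen_biInter_finset fun p _ => (qb_open p.2).preimage (continuous_apply p.1)

lemma bx_restrict {T : Type*} (S : Set T) (O : Set (T → unitInterval)) (hO : IsOpen O)
    (x : T → unitInterval) (hx : x ∈ O) (hxS : ∀ t, t ∉ S → x t = 0) :
    ∃ e : Finset (T × QB), (∀ p ∈ e, p.1 ∈ S) ∧ x ∈ bx e ∧
      ∀ z ∈ bx e, (∀ t, t ∉ S → z t = 0) → z ∈ O := by
  classical
  obtain ⟨e, hxe, heO⟩ := bx_basis hO hx
  refine ⟨e.filter fun p => p.1 ∈ S, fun p hp => (Finset.mem_filter.1 hp).2,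
    fun p hp => hxe p (Finset.mem_filter.1 hp).1, fun z hz hzS => heO ?_⟩
  intro p hp
  by_cases h : p.1 ∈ S
  · exact hz p (Finset.mem_filter.2 ⟨hp, h⟩)
  · rw [hzS _ h, ← hxS _ h]; exact hxe p hp

structure GoodPair {X Y T : Type*} [TopologicalSpace Y] (h : X → T → unitInterval) (f : X → Y)
    (S : Set T) (B : Set (TopologicalSpace.Clopens Y)) : Prop where
  top : ⊤ ∈ B
  inf : ∀ U ∈ B, ∀ V ∈ B, U ⊓ V ∈ B
  compl : ∀ U ∈ B, Uᶜ ∈ B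
  d : ∀ e : Finset (T × QB), (∀ p ∈ e, p.1 ∈ S) → ∀ x, h x ∈ bx e →
    ∃ z, h z ∈ bx e ∧ ∀ t, t ∉ S → h z t = 0
  dep : ∀ U ∈ B, ∀ x x', (∀ t ∈ S, h x t = h x' t) → f x ∈ U → f x' ∈ U
  img : ∀ e : Finset (T × QB), (∀ p ∈ e, p.1 ∈ S) → ∀ x, h x ∈ bx e →
    ∃ C ∈ B, f x ∈ C ∧ ∀ y ∈ C, ∃ x', h x' ∈ bx e ∧ f x' = y

lemma retr {X Y T : Type*} [TopologicalSpace X] [CompactSpace X] [T2Space X]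
    [TopologicalSpace Y] [CompactSpace Y] [T2Space Y]
    (h : X → T → unitInterval) (hemb : IsEmbedding h) (f : X → Y) (hf : Continuous f)
    (hfs : Function.Surjective f)
    (S : Set T) (B : Set (TopologicalSpace.Clopens Y)) (hS : S.Countable) (hB : B.Countable)
    (hG : GoodPair h f S B) :
    ∃ r : Y → Y, (∀ U ∈ B, ∀ y, r y ∈ U ↔ y ∈ U) ∧
      ∀ U : TopologicalSpace.Clopens Y, ∃ V ∈ B, ∀ y, r y ∈ U ↔ y ∈ V := by
  classical
  have hco : ∀ t, Continuous fun x => h x t := fun t => (continuous_apply t).comp hemb.continuous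
  let K : Set X := {x | ∀ t, t ∉ S → h x t = 0}
  have hK : IsClosed K := by
    have : K = ⋂ t, ⋂ (_ : t ∉ S), {x | h x t = 0} := by ext x; simp [K]
    rw [this]
    exact isClosed_iInter fun t => isClosed_iInter fun _ =>
      isClosed_eq (hco t) continuous_const
  have : CompactSpace K := isCompact_iff_compactSpace.1 hK.isCompact
  have : Countable S := hS.to_subtype
  have hmet : TopologicalSpace.MetrizableSpace K := by
    let g : K → S → unitInterval := fun x t => h x.1 t.1
    have hg : Continuous g := continuous_pi fun t => (hco t.1).comp continuous_subtype_val
    have hgi : Function.Injective g := by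
      intro x x' hxx
      apply Subtype.ext
      apply hemb.injective
      funext t
      by_cases ht : t ∈ S
      · exact congrFun hxx ⟨t, ht⟩
      · rw [x.2 t ht, x'.2 t ht]
    exact (hg.isClosedEmbedding hgi).isEmbedding.metrizableSpace
  let : MetricSpace K := TopologicalSpace.metrizableSpaceMetric K
  -- restriction
  have hres : ∀ x, ∃ x' ∈ K, ∀ t ∈ S, h x' t = h x t := by
    intro x
    let y : T → unitInterval := fun t => if t ∈ S then h x t else 0
    have hy : y ∈ closure (h '' K) := by
      rw [mem_closure_iff]
      intro O hO hyO
      obtain ⟨e, heS, hye, hz⟩ := bx_restrict S O hO y hyO (fun t ht => if_neg ht)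
      obtain ⟨z, hze, hzS⟩ := hG.d e heS x (by
        intro p hp
        have := hye p hp
        simpa only [y, if_pos (heS p hp)] using this)
      exact ⟨h z, hz _ hze hzS, z, hzS, rfl⟩
    rw [(hK.isCompact.image hemb.continuous).isClosed.closure_eq] at hy
    obtain ⟨x', hx', he⟩ := hy
    refine ⟨x', hx', fun t ht => ?_⟩
    rw [he]; exact if_pos ht
  let Φ : Y → Set K := fun y => {x | ∀ U ∈ B, f x.1 ∈ U ↔ y ∈ U}
  have hΦres : ∀ x x', (hx' : x' ∈ K) → (∀ t ∈ S, h x' t = h x t) →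
      (⟨x', hx'⟩ : K) ∈ Φ (f x) := by
    intro x x' hx' hxx U hU
    exact ⟨hG.dep U hU _ _ hxx, hG.dep U hU _ _ fun t ht => (hxx t ht).symm⟩
  have hcont : Continuous fun x : K => f x.1 := hf.comp continuous_subtype_val
  obtain ⟨s, hsΦ, hs⟩ := michaelB (Z := Y) (K := K)
    ((fun U : TopologicalSpace.Clopens Y => (U : Set Y)) '' B)
    (hB.image _) ⟨⊤, hG.top, rfl⟩
    (by
      rintro _ ⟨U, hU, rfl⟩ _ ⟨V, hV, rfl⟩
      exact ⟨U ⊓ V, hG.inf U hU V hV, rfl⟩)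
    (by
      rintro _ ⟨U, hU, rfl⟩
      exact ⟨Uᶜ, hG.compl U hU, rfl⟩)
    Φ
    (by
      intro y
      obtain ⟨x, rfl⟩ := hfs y
      obtain ⟨x', hx', hxx⟩ := hres x
      exact ⟨_, hΦres x x' hx' hxx⟩)
    (by
      intro y
      have : Φ y = ⋂ U ∈ B, {x : K | f x.1 ∈ U ↔ y ∈ U} := by ext x; simp [Φ]
      rw [this]
      refine isClosed_biInter fun U _ => ?_
      by_cases hy : y ∈ U
      · simp only [hy, iff_true]
        exact U.isClopen.isClosed.preimage hcont
      · simp only [hy, iff_false]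
        exact U.isClopen.compl.isClosed.preimage hcont)
    (by
      rintro W hW y ⟨x, hxΦ, hxW⟩
      obtain ⟨O, hO, rfl⟩ := isOpen_induced_iff.1 hW
      obtain ⟨O', hO', rfl⟩ := hemb.isInducing.isOpen_iff.1 hO
      obtain ⟨e, heS, hxe, hz⟩ := bx_restrict S O' hO' (h x.1) hxW x.2
      obtain ⟨C, hC, hfC, hCi⟩ := hG.img e heS x.1 hxe
      refine ⟨C, ⟨C, hC, rfl⟩, (hxΦ C hC).1 hfC, ?_⟩
      intro y' hy'
      obtain ⟨x₁, hx₁, rfl⟩ := hCi y' hy'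
      obtain ⟨x', hx', hxx⟩ := hres x₁
      refine ⟨⟨x', hx'⟩, hΦres _ _ hx' hxx, hz (h x') ?_ hx'⟩
      intro p hp
      rw [hxx _ (heS p hp)]
      exact hx₁ p hp)
  have hs' : ∀ U : TopologicalSpace.Clopens Y, ∀ y, f (s y).1 ∈ U →
      ∃ C ∈ B, y ∈ C ∧ ∀ y' ∈ C, f (s y').1 ∈ U := by
    intro U y hy
    obtain ⟨_, ⟨C, hC, rfl⟩, h1, h2⟩ := hs _ (U.isClopen.isOpen.preimage hcont) y hy
    exact ⟨C, hC, h1, h2⟩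
  refine ⟨fun y => f (s y).1, fun U hU y => hsΦ y U hU, fun U => ?_⟩
  have hclosed : IsClosed {y | f (s y).1 ∈ U} := by
    rw [← isOpen_compl_iff, isOpen_iff_mem_nhds]
    intro y hy
    obtain ⟨C, _, h1, h2⟩ := hs' Uᶜ y hy
    exact Filter.mem_of_superset (C.isClopen.isOpen.mem_nhds h1) h2
  have : ∃ V ∈ B, {y | f (s y).1 ∈ U} ⊆ V ∧ ∀ y ∈ V, f (s y).1 ∈ U := by
    refine hclosed.isCompact.induction_on
      (p := fun A => ∃ V ∈ B, A ⊆ V ∧ ∀ y ∈ V, f (s y).1 ∈ U) ?_ ?_ ?_ ?_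
    · exact ⟨⊤ᶜ, hG.compl _ hG.top, empty_subset _, fun y hy => absurd trivial hy⟩
    · rintro A A' hA ⟨V, hV, h1, h2⟩
      exact ⟨V, hV, hA.trans h1, h2⟩
    · rintro A A' ⟨V, hV, h1, h2⟩ ⟨V', hV', h1', h2'⟩
      refine ⟨(Vᶜ ⊓ V'ᶜ)ᶜ, hG.compl _ (hG.inf _ (hG.compl _ hV) _ (hG.compl _ hV')), ?_, ?_⟩
      · rintro y (hy | hy) hn
        · exact hn.1 (h1 hy)
        · exact hn.2 (h1' hy)
      · intro y hy
        by_contra hn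
        exact hy ⟨fun hh => hn (h2 y hh), fun hh => hn (h2' y hh)⟩
    · intro y hy
      obtain ⟨C, hC, h1, h2⟩ := hs' U y hy
      exact ⟨C, mem_nhdsWithin_of_mem_nhds (C.isClopen.isOpen.mem_nhds h1), C, hC, Subset.rfl, h2⟩
  obtain ⟨V, hV, h1, h2⟩ := this
  exact ⟨V, hV, fun y => ⟨fun hy => h1 hy, h2 y⟩⟩

lemma choose_dep {X Y T : Type*} [TopologicalSpace X] [CompactSpace X]
    [TopologicalSpace Y]
    (h : X → T → unitInterval) (hemb : IsEmbedding h) (f : X → Y) (hf : Continuous f)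
    (U : TopologicalSpace.Clopens Y) :
    ∃ F : Set T, F.Countable ∧ ∀ x x', (∀ t ∈ F, h x t = h x' t) → f x ∈ U → f x' ∈ U := by
  classical
  have := ((U.isClopen.isClosed.preimage hf).isCompact).induction_on
    (p := fun A => ∃ F : Set T, F.Countable ∧
      ∀ x ∈ A, ∀ x', (∀ t ∈ F, h x t = h x' t) → f x' ∈ U)
    ⟨∅, countable_empty, fun x hx => hx.elim⟩
    (by
      rintro A A' hA ⟨F, hF, h1⟩
      exact ⟨F, hF, fun x hx => h1 x (hA hx)⟩)
    (by
      rintro A A' ⟨F, hF, h1⟩ ⟨F', hF', h1'⟩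
      refine ⟨F ∪ F', hF.union hF', ?_⟩
      rintro x (hx | hx) x' hxx
      · exact h1 x hx x' fun t ht => hxx t (Or.inl ht)
      · exact h1' x hx x' fun t ht => hxx t (Or.inr ht))
    (by
      intro x hx
      obtain ⟨O, hO, hOU⟩ := hemb.isInducing.isOpen_iff.1 (U.isClopen.isOpen.preimage hf)
      have hxO : h x ∈ O := by
        have : x ∈ h ⁻¹' O := by rw [hOU]; exact hx
        exact this
      obtain ⟨e, hxe, heO⟩ := bx_basis hO hxO
      refine ⟨h ⁻¹' bx e, mem_nhdsWithin_of_mem_nhds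
        (((bx_open e).preimage hemb.continuous).mem_nhds hxe),
        ↑(e.image Prod.fst), (Finset.countable_toSet _), ?_⟩
      intro z hz x' hzx
      have : x' ∈ h ⁻¹' O := by
        refine heO fun p hp => ?_
        rw [← hzx p.1 (Finset.mem_coe.2 (Finset.mem_image_of_mem _ hp))]
        exact hz p hp
      rw [hOU] at this
      exact this)
  obtain ⟨F, hF, h1⟩ := this
  exact ⟨F, hF, fun x x' hxx hx => h1 x hx x' hxx⟩

lemma choose_d {X T : Type*} [TopologicalSpace X]
    (h : X → T → unitInterval) (hh : IsValdiviaEmbedding h) (e : Finset (T × QB)) :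
    ∃ A : Set T, A.Countable ∧ ∀ x, h x ∈ bx e → ∃ z, h z ∈ bx e ∧ ∀ t, t ∉ A → h z t = 0 := by
  by_cases hne : ∃ x, h x ∈ bx e
  · obtain ⟨x, hx⟩ := hne
    have : h x ∈ closure (range h ∩ SigmaProd T) := hh.2 ▸ mem_range_self x
    obtain ⟨_, hz, ⟨z, rfl⟩, hzS⟩ := mem_closure_iff.1 this _ (bx_open e) hx
    exact ⟨{t | h z t ≠ 0}, hzS, fun _ _ => ⟨z, hz, fun t ht => not_not.1 ht⟩⟩
  · exact ⟨∅, countable_empty, fun x hx => absurd ⟨x, hx⟩ hne⟩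

lemma choose_img {X Y T : Type*} [TopologicalSpace X] [CompactSpace X]
    [TopologicalSpace Y] [CompactSpace Y] [T2Space Y] [TotallyDisconnectedSpace Y]
    (h : X → T → unitInterval) (hc : Continuous h) (f : X → Y) (hf : Continuous f)
    (hfo : IsOpenMap f) (e : Finset (T × QB)) :
    ∃ D : Set (TopologicalSpace.Clopens Y), D.Countable ∧ ∀ x, h x ∈ bx e →
      ∃ C ∈ D, f x ∈ C ∧ ∀ y ∈ C, ∃ x', h x' ∈ bx e ∧ f x' = y := by
  let g : X → (↥e → unitInterval) := fun x p => h x p.1.1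
  have hg : Continuous g := continuous_pi fun p => (continuous_apply p.1.1).comp hc
  let O : Set (↥e → unitInterval) := Set.pi univ fun p => (p.1.2 : Set unitInterval)
  have hO : IsOpen O := isOpen_set_pi finite_univ fun p _ => qb_open p.1.2
  obtain ⟨F, hFc, hFO, hFU, _⟩ := hO.exists_iUnion_isClosed
  have hgO : ∀ x, g x ∈ O ↔ h x ∈ bx e := by
    intro x
    exact ⟨fun hx p hp => hx ⟨p, hp⟩ trivial, fun hx p _ => hx p.1 p.2⟩
  have hop : IsOpen (f '' (h ⁻¹' bx e)) := hfo _ ((bx_open e).preimage hc)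
  have : ∀ n, ∃ C : TopologicalSpace.Clopens Y, f '' (g ⁻¹' F n) ⊆ C ∧
      (C : Set Y) ⊆ f '' (h ⁻¹' bx e) := by
    intro n
    obtain ⟨C, hC, h1, h2⟩ := exists_clopen_of_closed_subset_open
      (((hFc n).preimage hg).isCompact.image hf).isClosed hop
      (image_mono fun x hx => (hgO x).1 (hFO n hx))
    exact ⟨⟨C, hC⟩, h1, h2⟩
  choose C hC1 hC2 using this
  refine ⟨range C, countable_range C, fun x hx => ?_⟩
  have hx' := (hgO x).2 hx
  rw [← hFU] at hx'
  obtain ⟨n, hn⟩ := mem_iUnion.1 hx'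
  exact ⟨C n, mem_range_self n, hC1 n ⟨x, hn, rfl⟩, fun y hy => hC2 n hy⟩

/-- if `X` is Valdivia compact and `f : X → Y` is a continuous open
surjection onto a zero-dimensional (totally disconnected) compact Hausdorff space `Y`
of weight at most `ℵ₁`, then `Y` is Valdivia compact. -/
theorem statement14 {X : Type u} [TopologicalSpace X] [CompactSpace X] [T2Space X]
    {Y : Type v} [TopologicalSpace Y] [CompactSpace Y] [T2Space Y]
    [TotallyDisconnectedSpace Y]
    (hX : IsValdivia X)
    (f : X → Y) (hf : Continuous f) (hfo : IsOpenMap f) (hfs : Function.Surjective f)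
    (hw : tweight Y ≤ Cardinal.aleph 1) :
    IsValdivia Y := by
  classical
  obtain ⟨T, h, hh⟩ := hX
  choose A hAc hA using choose_d h hh
  choose F hFc hF using choose_dep h hh.1 f hf
  choose D hDc hD using choose_img h hh.1.continuous f hf hfo
  let P := T ⊕ TopologicalSpace.Clopens Y
  let O1 : Finset P → Set P := fun s =>
    ⋃ e ∈ {e : Finset (T × QB) | ∀ p ∈ e, (Sum.inl p.1 : P) ∈ s}, (Sum.inl '' A e ∪ Sum.inr '' D e)
  let O2 : Finset P → Set P := fun s =>
    ⋃ U ∈ {U : TopologicalSpace.Clopens Y | (Sum.inr U : P) ∈ s},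
      (Sum.inl '' F U ∪ {Sum.inr Uᶜ, Sum.inr ⊤})
  let O3 : Finset P → Set P := fun s =>
    ⋃ U ∈ {U : TopologicalSpace.Clopens Y | (Sum.inr U : P) ∈ s},
    ⋃ V ∈ {U : TopologicalSpace.Clopens Y | (Sum.inr U : P) ∈ s}, {Sum.inr (U ⊓ V)}
  let Op : Finset P → Set P := fun s => (O1 s ∪ O2 s) ∪ (O3 s ∪ {Sum.inr ⊤})
  have hc2 : ∀ s : Finset P,
      {U : TopologicalSpace.Clopens Y | (Sum.inr U : P) ∈ s}.Countable := fun s =>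
    (s.countable_toSet).preimage Sum.inr_injective
  have hc1 : ∀ s : Finset P,
      {e : Finset (T × QB) | ∀ p ∈ e, (Sum.inl p.1 : P) ∈ s}.Countable := by
    intro s
    have h1 : {t : T | (Sum.inl t : P) ∈ s}.Countable :=
      (s.countable_toSet).preimage Sum.inl_injective
    have h2 : ({t : T | (Sum.inl t : P) ∈ s} ×ˢ (univ : Set QB)).Countable :=
      h1.prod (Set.to_countable _)
    refine ((Set.countable_ofPred_finite_subset h2).preimage
          (Finset.coe_injective (α := T × QB))).mono ?_
    intro e he
    exact ⟨e.finite_toSet, fun p hp => ⟨he p hp, trivial⟩⟩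
  have hOp : ∀ s, (Op s).Countable := by
    intro s
    refine Countable.union (Countable.union ?_ ?_) (Countable.union ?_ (countable_singleton _))
    · exact (hc1 s).biUnion fun e _ => ((hAc e).image _).union ((hDc e).image _)
    · exact (hc2 s).biUnion fun U _ => ((hFc U).image _).union (Set.to_countable _)
    · exact (hc2 s).biUnion fun U _ => (hc2 s).biUnion fun V _ => countable_singleton _
  obtain ⟨cl, k1, k2, k3, k4, k5⟩ := cl_exists Op hOp
  have hgood : ∀ N, GoodPair h f (Sum.inl ⁻¹' cl N) (Sum.inr ⁻¹' cl N) := by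
    intro N
    have hbox : ∀ e : Finset (T × QB), (∀ p ∈ e, p.1 ∈ (Sum.inl ⁻¹' cl N : Set T)) →
        (Sum.inl '' A e ∪ Sum.inr '' D e : Set P) ⊆ cl N := by
      intro e he
      refine Subset.trans ?_ (k3 N (e.image fun p => Sum.inl p.1) ?_)
      · refine Subset.trans ?_ (subset_union_left.trans subset_union_left)
        refine subset_biUnion_of_mem
          (u := fun e : Finset (T × QB) => (Sum.inl '' A e ∪ Sum.inr '' D e : Set P)) ?_
        intro p hp
        exact Finset.mem_image_of_mem (fun p : T × QB => (Sum.inl p.1 : P)) hp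
      · intro q hq
        obtain ⟨p, hp, rfl⟩ := Finset.mem_image.1 (Finset.mem_coe.1 hq)
        exact he p hp
    have hone : ∀ U : TopologicalSpace.Clopens Y, (Sum.inr U : P) ∈ cl N →
        (Sum.inl '' F U ∪ {Sum.inr Uᶜ, Sum.inr ⊤} : Set P) ⊆ cl N := by
      intro U hU
      refine Subset.trans ?_ (k3 N {Sum.inr U} (by simpa using hU))
      refine Subset.trans ?_ (subset_union_right.trans subset_union_left)
      exact subset_biUnion_of_mem
          (u := fun U : TopologicalSpace.Clopens Y =>
            (Sum.inl '' F U ∪ {Sum.inr Uᶜ, Sum.inr ⊤} : Set P)) (Finset.mem_singleton_self _)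
    refine ⟨?_, ?_, ?_, ?_, ?_, ?_⟩
    · exact k3 N ∅ (by simp) (Or.inr (Or.inr rfl))
    · intro U hU V hV
      refine k3 N ({Sum.inr U, Sum.inr V} : Finset P) ?_ (Or.inr (Or.inl ?_))
      · intro q hq
        rcases (by simpa using hq : q = Sum.inr U ∨ q = Sum.inr V) with rfl | rfl
        · exact hU
        · exact hV
      · refine mem_biUnion (x := U) ?_ (mem_biUnion (x := V) ?_ rfl)
        · exact Finset.mem_insert_self (Sum.inr U : P) {Sum.inr V}
        · exact Finset.mem_insert_of_mem (Finset.mem_singleton_self (Sum.inr V : P))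
    · intro U hU
      exact hone U hU (Or.inr (Or.inl rfl))
    · intro e he x hx
      obtain ⟨z, hz, hzA⟩ := hA e x hx
      exact ⟨z, hz, fun t ht => hzA t fun htA => ht (hbox e he (Or.inl ⟨t, htA, rfl⟩))⟩
    · intro U hU x x' hxx
      exact hF U x x' fun t ht => hxx t (hone U hU (Or.inl ⟨t, ht, rfl⟩))
    · intro e he x hx
      obtain ⟨C, hC, hC'⟩ := hD e x hx
      exact ⟨C, hbox e he (Or.inr ⟨C, hC, rfl⟩), hC'⟩
  have hcount : ∀ N : Set (TopologicalSpace.Clopens Y), N.Countable →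
      (cl (Sum.inr '' N)).Countable := fun N hN => k4 _ (hN.image _)
  refine valdivia_of_closure (clopens_card hw) (fun N => Sum.inr ⁻¹' cl (Sum.inr '' N))
    ?_ ?_ ?_ ?_ ?_ ?_
  · intro N U hU
    exact k1 _ ⟨U, hU, rfl⟩
  · intro N N' hN U hU
    exact k2 _ _ (image_mono hN) hU
  · intro N U hU
    obtain ⟨s, hs, hUs⟩ := k5 _ _ hU
    obtain ⟨s', hs', rfl⟩ := Finset.subset_set_image_iff.1 hs
    exact ⟨s', hs', by simpa using hUs⟩
  · intro N hN
    exact (hcount N hN).preimage Sum.inr_injective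
  · intro N U hU V hV
    rw [_root_.sdiff_eq]
    exact (hgood _).inf U hU _ ((hgood _).compl V hV)
  · intro N hN
    exact retr h hh.1 f hf hfs _ _ ((hcount N hN).preimage Sum.inl_injective)
      ((hcount N hN).preimage Sum.inr_injective) (hgood _)
end

section
/- Every retract of a product of compact metrizable spaces is Valdivia compact. That is, if X = Π_{i∈I} M_i where each M_i is a compact metrizable space, and Y is a topological space for which there exist continuous maps f : X → Y and g : Y → X with f ∘ g = id_Y, then Y is Valdivia compact. -/
open Set Filter Topology

universe u v

universe w

open Classical in
/-- glue two points of a product along a set of coordinates -/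
noncomputable def rvMix {I : Type*} {M : I → Type*} (S : Set I) (x y : ∀ i, M i) : ∀ i, M i :=
  fun c => if c ∈ S then x c else y c

theorem rvMix_mem {I : Type*} {M : I → Type*} {S : Set I} {x y : ∀ i, M i} {c : I} (h : c ∈ S) :
    rvMix S x y c = x c := by simp [rvMix, h]

theorem rvMix_notMem {I : Type*} {M : I → Type*} {S : Set I} {x y : ∀ i, M i} {c : I}
    (h : c ∉ S) : rvMix S x y c = y c := by simp [rvMix, h]

theorem rvMix_congr {I : Type*} {M : I → Type*} {S : Set I} {x x' y : ∀ i, M i}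
    (h : ∀ c ∈ S, x c = x' c) : rvMix S x y = rvMix S x' y := by
  funext c
  by_cases hc : c ∈ S
  · rw [rvMix_mem hc, rvMix_mem hc, h c hc]
  · rw [rvMix_notMem hc, rvMix_notMem hc]

theorem rvMix_self {I : Type*} {M : I → Type*} {S : Set I} {x : ∀ i, M i} :
    rvMix S x x = x := by
  funext c
  by_cases hc : c ∈ S
  · rw [rvMix_mem hc]
  · rw [rvMix_notMem hc]

theorem rvMix_continuous {I : Type*} {M : I → Type*} [∀ i, TopologicalSpace (M i)] (S : Set I)
    (y : ∀ i, M i) : Continuous (fun x => rvMix S x y) := by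
  refine continuous_pi fun c => ?_
  by_cases hc : c ∈ S
  · simp only [rvMix_mem hc]; exact continuous_apply c
  · simp only [rvMix_notMem hc]; exact continuous_const

/-- admissible sets of coordinates -/
def RvAdm {I : Type*} {M : I → Type*} (r : (∀ i, M i) → ∀ i, M i) (S : Set I) : Prop :=
  ∀ x y : ∀ i, M i, (∀ c ∈ S, x c = y c) → ∀ c ∈ S, r x c = r y c

theorem rv_dep {I : Type*} {M : I → Type*} [∀ i, TopologicalSpace (M i)]
    [∀ i, CompactSpace (M i)] {Z : Type*} [TopologicalSpace Z]
    [TopologicalSpace.MetrizableSpace Z] (φ : (∀ i, M i) → Z) (hφ : Continuous φ) :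
    ∃ N : Set I, N.Countable ∧ ∀ x y : ∀ i, M i, (∀ c ∈ N, x c = y c) → φ x = φ y := by
  let _ := TopologicalSpace.metrizableSpaceMetric Z
  have key : ∀ ε : ℝ, 0 < ε → ∃ F : Finset I, ∀ x ∈ (univ : Set (∀ i, M i)), ∀ y : ∀ i, M i,
      (∀ c ∈ F, x c = y c) → dist (φ x) (φ y) < ε := by
    intro ε hε
    refine isCompact_univ.induction_on
      (p := fun s => ∃ F : Finset I, ∀ x ∈ s, ∀ y : ∀ i, M i,
      (∀ c ∈ F, x c = y c) → dist (φ x) (φ y) < ε) ⟨∅, by simp⟩ ?_ ?_ ?_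
    · rintro s t hst ⟨F, hF⟩
      exact ⟨F, fun x hx => hF x (hst hx)⟩
    · classical
      rintro s t ⟨F, hF⟩ ⟨G, hG⟩
      refine ⟨F ∪ G, ?_⟩
      rintro x (hx | hx) y h
      · exact hF x hx y fun c hc => h c (Finset.mem_union_left _ hc)
      · exact hG x hx y fun c hc => h c (Finset.mem_union_right _ hc)
    · intro x _
      have ho : IsOpen (φ ⁻¹' Metric.ball (φ x) (ε / 2)) := Metric.isOpen_ball.preimage hφ
      obtain ⟨F, u, hu, hsub⟩ := isOpen_pi_iff.1 ho x (by simp [hε])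
      refine ⟨(F : Set I).pi u, ?_, F, ?_⟩
      · exact mem_nhdsWithin_of_mem_nhds ((isOpen_set_pi F.finite_toSet
          (fun c hc => (hu c hc).1)).mem_nhds fun c hc => (hu c hc).2)
      · intro y hy z hz
        have hz' : z ∈ (F : Set I).pi u := fun c hc => by
          rw [← hz c hc]; exact hy c hc
        have h1 := hsub hy
        have h2 := hsub hz'
        simp only [mem_preimage, Metric.mem_ball] at h1 h2
        have := dist_triangle_right (φ y) (φ z) (φ x)
        linarith
  choose F hF using fun n : ℕ => key (1 / ((n : ℝ) + 1)) Nat.one_div_pos_of_nat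
  refine ⟨⋃ n, (F n : Set I), countable_iUnion fun n => (F n).countable_toSet, ?_⟩
  intro x y h
  by_contra hne
  obtain ⟨n, hn⟩ := exists_nat_one_div_lt (dist_pos.2 hne)
  have := hF n x trivial y fun c hc => h c (mem_iUnion.2 ⟨n, hc⟩)
  linarith

theorem rv_adm_countable {I : Type*} {M : I → Type*} [∀ i, TopologicalSpace (M i)]
    [∀ i, CompactSpace (M i)] [∀ i, TopologicalSpace.MetrizableSpace (M i)]
    (r : (∀ i, M i) → ∀ i, M i) (hr : Continuous r) (i : I) :
    ∃ J : Set I, J.Countable ∧ i ∈ J ∧ RvAdm r J := by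
  choose N hNc hN using fun c => rv_dep (fun x => r x c) ((continuous_apply c).comp hr)
  let A : ℕ → Set I := fun n => Nat.rec {i} (fun _ B => ⋃ c ∈ B, N c) n
  refine ⟨⋃ n, A n, countable_iUnion fun n => ?_, mem_iUnion.2 ⟨0, rfl⟩, ?_⟩
  · induction n with
    | zero => exact countable_singleton i
    | succ n ih => exact ih.biUnion fun c _ => hNc c
  · intro x y h c hc
    obtain ⟨n, hn⟩ := mem_iUnion.1 hc
    exact hN c x y fun d hd => h d (mem_iUnion.2 ⟨n + 1, mem_iUnion₂.2 ⟨c, hn, hd⟩⟩)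

theorem rv_rank {I : Type*} {M : I → Type*} [∀ i, TopologicalSpace (M i)]
    [∀ i, CompactSpace (M i)] [∀ i, TopologicalSpace.MetrizableSpace (M i)]
    (r : (∀ i, M i) → ∀ i, M i) (hr : Continuous r) :
    ∃ (_ : LinearOrder I) (_ : WellFoundedLT I) (ρ : I → I),
      (∀ j, {c | ρ c = j}.Countable) ∧
      (∀ j, RvAdm r {c | ρ c < j}) ∧ (∀ j, RvAdm r {c | ρ c ≤ j}) := by
  choose J hJc hJi hJ using rv_adm_countable r hr
  obtain ⟨lo, wf⟩ := exists_wellFoundedLT I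
  have hne : ∀ c, {j | c ∈ J j}.Nonempty := fun c => ⟨c, hJi c⟩
  let ρ : I → I := fun c => wellFounded_lt.min {j | c ∈ J j} (hne c)
  have h1 : ∀ c, c ∈ J (ρ c) := fun c => wellFounded_lt.min_mem _ (hne c)
  have h2 : ∀ c j, c ∈ J j → ρ c ≤ j := fun c j h => not_lt.1 (wellFounded_lt.not_lt_min {j | c ∈ J j} h)
  refine ⟨lo, wf, ρ, fun j => (hJc j).mono ?_, ?_, ?_⟩
  · rintro c rfl; exact h1 c
  · intro j x y h c hc
    exact hJ (ρ c) x y (fun d hd => h d (lt_of_le_of_lt (h2 d _ hd) hc)) c (h1 c)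
  · intro j x y h c hc
    exact hJ (ρ c) x y (fun d hd => h d (le_trans (h2 d _ hd) hc)) c (h1 c)

/-- the support of a point -/
def rvSupp {I : Type*} [LinearOrder I] {M : I → Type*} (r : (∀ i, M i) → ∀ i, M i)
    (ρ : I → I) (a x : ∀ i, M i) : Set I :=
  {c | x c ≠ r (rvMix {d | ρ d < ρ c} x a) c}

theorem rvSupp_congr {I : Type*} [LinearOrder I] {M : I → Type*} {r : (∀ i, M i) → ∀ i, M i}
    {ρ : I → I} {a x y : ∀ i, M i} {c : I} (h : ∀ d, ρ d ≤ ρ c → x d = y d)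
    (hc : c ∈ rvSupp r ρ a x) : c ∈ rvSupp r ρ a y := by
  simp only [rvSupp, mem_ofPred_eq] at hc ⊢
  rwa [← rvMix_congr (S := {d | ρ d < ρ c}) (x := x) (x' := y) (fun d hd => h d (le_of_lt hd)), ← h c le_rfl]

open Classical in
theorem rv_extend {I : Type*} [LinearOrder I] [WellFoundedLT I] {M : I → Type*}
    (r : (∀ i, M i) → ∀ i, M i) (hrr : ∀ x, r (r x) = r x)
    (ρ : I → I) (h1 : ∀ j, RvAdm r {c | ρ c < j}) (h2 : ∀ j, RvAdm r {c | ρ c ≤ j})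
    (a y : ∀ i, M i) (hy : r y = y) (L : Set I) (hL : IsLowerSet L) :
    ∃ z, r z = z ∧ (∀ c, ρ c ∈ L → z c = y c) ∧ ∀ c ∈ rvSupp r ρ a z, ρ c ∈ L := by
  have wf : WellFounded (fun c d : I => ρ c < ρ d) := InvImage.wf ρ wellFounded_lt
  let z : ∀ i, M i := wf.fix (C := M) fun c ih =>
    if ρ c ∈ L then y c else r (fun d => if h : ρ d < ρ c then ih d h else a d) c
  have hz : ∀ c, z c = if ρ c ∈ L then y c else r (rvMix {d | ρ d < ρ c} z a) c := by
    intro c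
    have : rvMix {d | ρ d < ρ c} z a = fun d => if h : ρ d < ρ c then z d else a d := by
      funext d
      simp [rvMix]
    rw [this]
    exact wf.fix_eq _ c
  have hzL : ∀ c, ρ c ∈ L → z c = y c := fun c hc => by rw [hz, if_pos hc]
  have hzN : ∀ c, ρ c ∉ L → z c = r (rvMix {d | ρ d < ρ c} z a) c :=
    fun c hc => by conv_lhs => rw [hz, if_neg hc]
  have main : ∀ j c, ρ c = j → r z c = z c := by
    intro j
    induction j using WellFoundedLT.induction with
    | _ j ih =>
    intro c hc
    by_cases hj : j ∈ L
    · have hj' : ∀ d ∈ {d | ρ d ≤ j}, z d = y d := fun d hd => hzL d (hL hd hj)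
      rw [h2 j z y hj' c hc.le, hy, hj' c hc.le]
    · set u := rvMix {d | ρ d < j} z a with hu
      have e : ∀ d ∈ {d | ρ d ≤ j}, z d = r u d := by
        intro d hd
        rcases lt_or_eq_of_le (show ρ d ≤ j from hd) with hlt | heq
        · rw [← ih _ hlt d rfl]
          exact h1 j z u (fun e he => by rw [hu, rvMix_mem he]) d hlt
        · rw [hzN d (by rwa [heq]), heq]
      rw [h2 j z (r u) e c hc.le, hrr, ← e c hc.le]
  refine ⟨z, funext fun c => main _ c rfl, hzL, fun c hc => ?_⟩
  by_contra hn
  exact hc (hzN c hn)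

theorem rv_step {I : Type*} [LinearOrder I] [WellFoundedLT I] {M : I → Type*}
    [∀ i, TopologicalSpace (M i)]
    (r : (∀ i, M i) → ∀ i, M i) (hr : Continuous r) (hrr : ∀ x, r (r x) = r x)
    (ρ : I → I) (hρ : ∀ j, {c | ρ c = j}.Countable)
    (h1 : ∀ j, RvAdm r {c | ρ c < j}) (h2 : ∀ j, RvAdm r {c | ρ c ≤ j})
    (a : ∀ i, M i) (A : Set I)
    (ih : ∀ k ∈ A, ∀ V : Set (∀ i, M i), IsOpen V →
      (∀ x x', x ∈ V → (∀ c, ρ c < k → x c = x' c) → x' ∈ V) → ∀ y ∈ V, r y = y →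
      ∃ z ∈ V, r z = z ∧ (rvSupp r ρ a z).Countable)
    (V : Set (∀ i, M i)) (hV : IsOpen V)
    (hVs : ∀ x x', x ∈ V → (∀ c, ρ c ∈ A → x c = x' c) → x' ∈ V)
    (y : ∀ i, M i) (hyV : y ∈ V) (hy : r y = y) :
    ∃ z ∈ V, r z = z ∧ (rvSupp r ρ a z).Countable := by
  classical
  obtain ⟨F, u, hu, hsub⟩ := isOpen_pi_iff.1 hV y hyV
  let G := F.filter fun c => ρ c ∈ A
  let V1 : Set (∀ i, M i) := (G : Set I).pi u
  have hGF : ∀ c ∈ G, c ∈ F := fun c hc => (Finset.mem_filter.1 hc).1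
  have hV1 : IsOpen V1 := isOpen_set_pi G.finite_toSet fun c hc => (hu c (hGF c hc)).1
  have hyV1 : y ∈ V1 := fun c hc => (hu c (hGF c hc)).2
  have hV1V : V1 ⊆ V := by
    intro x hx
    refine hVs (rvMix {c | ρ c ∈ A} x y) x (hsub ?_) fun c hc => rvMix_mem hc
    intro c hc
    by_cases hcA : ρ c ∈ A
    · rw [rvMix_mem (show c ∈ {c | ρ c ∈ A} from hcA)]
      exact hx c (Finset.mem_coe.2 (Finset.mem_filter.2 ⟨hc, hcA⟩))
    · rw [rvMix_notMem (show c ∉ {c | ρ c ∈ A} from hcA)]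
      exact (hu c hc).2
  rcases G.eq_empty_or_nonempty with hG | hG
  · obtain ⟨z, hz, -, hzs⟩ := rv_extend r hrr ρ h1 h2 a y hy ∅ isLowerSet_empty
    refine ⟨z, hV1V ?_, hz, ?_⟩
    · simp [V1, hG]
    · exact countable_empty.mono fun c hc => (hzs c hc).elim
  · obtain ⟨m, hm, hmax⟩ := G.exists_max_image ρ hG
    set k := ρ m with hk
    have hkA : k ∈ A := (Finset.mem_filter.1 hm).2
    let V' : Set (∀ i, M i) := {w | r (rvMix {c | ρ c < k} w y) ∈ V1}
    have hV' : IsOpen V' := hV1.preimage (hr.comp (rvMix_continuous _ y))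
    obtain ⟨y', hy'V, hy', hy's⟩ := ih k hkA V' hV'
      (fun x x' hx hxx => by
        simp only [V', mem_ofPred_eq] at hx ⊢
        rwa [← rvMix_congr (S := {c | ρ c < k}) (x := x) (x' := x') (fun d hd => hxx d hd)])
      y (by simp only [V', mem_ofPred_eq, rvMix_self, hy]; exact hyV1) hy
    set y'' := r (rvMix {c | ρ c < k} y' y) with hy''
    have e1 : ∀ c, ρ c < k → y'' c = y' c := by
      intro c hc
      rw [hy'', h1 k _ y' (fun d hd => rvMix_mem hd) c hc, hy']
    obtain ⟨z, hz, hzy, hzs⟩ := rv_extend r hrr ρ h1 h2 a y'' (hrr _) (Iic k) (isLowerSet_Iic k)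
    refine ⟨z, hV1V ?_, hz, (hy's.union (hρ k)).mono ?_⟩
    · intro c hc
      rw [hzy c (hmax c hc)]
      exact hy'V c hc
    · intro c hc
      have hck : ρ c ≤ k := hzs c hc
      rcases lt_or_eq_of_le hck with hlt | heq
      · left
        refine rvSupp_congr (fun d hd => ?_) hc
        rw [hzy d (hd.trans hck), e1 d (lt_of_le_of_lt hd hlt)]
      · right; exact heq

theorem rv_dense {I : Type*} [LinearOrder I] [WellFoundedLT I] {M : I → Type*}
    [∀ i, TopologicalSpace (M i)]
    (r : (∀ i, M i) → ∀ i, M i) (hr : Continuous r) (hrr : ∀ x, r (r x) = r x)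
    (ρ : I → I) (hρ : ∀ j, {c | ρ c = j}.Countable)
    (h1 : ∀ j, RvAdm r {c | ρ c < j}) (h2 : ∀ j, RvAdm r {c | ρ c ≤ j})
    (a : ∀ i, M i) (V : Set (∀ i, M i)) (hV : IsOpen V)
    (y : ∀ i, M i) (hyV : y ∈ V) (hy : r y = y) :
    ∃ z ∈ V, r z = z ∧ (rvSupp r ρ a z).Countable := by
  refine rv_step r hr hrr ρ hρ h1 h2 a univ ?_ V hV ?_ y hyV hy
  · intro k _
    induction k using WellFoundedLT.induction with
    | _ k ih =>
    intro V hV hVs y hyV hy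
    exact rv_step r hr hrr ρ hρ h1 h2 a (Iio k) (fun j hj => ih j hj trivial) V hV hVs y hyV hy
  · intro x x' hx h
    have : x = x' := funext fun c => h c trivial
    exact this ▸ hx

theorem rv_valdivia_of {Y : Type w} [TopologicalSpace Y] [CompactSpace Y] {T : Type*}
    (h : T → Y → unitInterval) (hc : ∀ t, Continuous (h t))
    (hinj : ∀ y y', (∀ t, h t y = h t y') → y = y')
    (hd : ∀ (U : Set Y), IsOpen U → ∀ y ∈ U, ∃ z ∈ U, {t | h t z ≠ 0}.Countable) :
    IsValdivia Y := by
  let H : Y → range h → unitInterval := fun y φ => φ.1 y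
  have hH : Continuous H := by
    refine continuous_pi ?_
    rintro ⟨_, t, rfl⟩
    exact hc t
  have hHi : Function.Injective H := fun y y' e =>
    hinj y y' fun t => congrFun e ⟨h t, t, rfl⟩
  refine ⟨range h, H, (hH.isClosedEmbedding hHi).isEmbedding, ?_⟩
  apply Subset.antisymm
  · rintro _ ⟨y, rfl⟩
    rw [mem_closure_iff]
    intro O hO hyO
    obtain ⟨z, hzU, hz⟩ := hd (H ⁻¹' O) (hO.preimage hH) y hyO
    refine ⟨H z, hzU, ⟨z, rfl⟩, ?_⟩
    refine (hz.image (fun t => (⟨h t, t, rfl⟩ : range h))).mono ?_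
    rintro ⟨_, t, rfl⟩ ht
    exact ⟨t, ht, rfl⟩
  · exact closure_minimal inter_subset_left (hH.isClosedEmbedding hHi).isClosed_range

theorem rv_coords (Z : Type*) [TopologicalSpace Z] [CompactSpace Z]
    [TopologicalSpace.MetrizableSpace Z] [Nonempty Z] :
    ∃ e : ℕ → Z → unitInterval, (∀ n, Continuous (e n)) ∧
      ∀ x y, (∀ n, e n x = e n y) → x = y := by
  let _ := TopologicalSpace.metrizableSpaceMetric Z
  refine ⟨Metric.PiNatEmbed.distDenseSeq Z, Metric.PiNatEmbed.continuous_distDenseSeq, fun x y h => ?_⟩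
  by_contra hne
  obtain ⟨n, hn⟩ := Metric.PiNatEmbed.injective_distDenseSeq x y hne
  exact hn (h n)

theorem rv_proj {u u' v : unitInterval}
    (h1 : projIcc (0 : ℝ) 1 zero_le_one (u - v) = projIcc (0 : ℝ) 1 zero_le_one (u' - v))
    (h2 : projIcc (0 : ℝ) 1 zero_le_one (v - u) = projIcc (0 : ℝ) 1 zero_le_one (v - u')) :
    u = u' := by
  have h1' := congrArg Subtype.val h1
  have h2' := congrArg Subtype.val h2
  simp only [coe_projIcc] at h1' h2'
  have a1 := u.2.1
  have a2 := u.2.2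
  have a3 := u'.2.1
  have a4 := u'.2.2
  have a5 := v.2.1
  have a6 := v.2.2
  rw [min_eq_right (by linarith), min_eq_right (by linarith)] at h1' h2'
  apply Subtype.ext
  rcases max_cases (0 : ℝ) (u - v) with ⟨p, _⟩ | ⟨p, _⟩ <;>
  rcases max_cases (0 : ℝ) (u' - v) with ⟨q, _⟩ | ⟨q, _⟩ <;>
  rcases max_cases (0 : ℝ) (v - u) with ⟨s, _⟩ | ⟨s, _⟩ <;>
  rcases max_cases (0 : ℝ) (v - u') with ⟨t, _⟩ | ⟨t, _⟩ <;>
  linarith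

/-- every retract of a product of compact metrizable spaces is Valdivia
compact: if `X = Π_{i∈I} M_i` with each `M_i` compact metrizable and there are
continuous `f : X → Y`, `g : Y → X` with `f ∘ g = id` then `Y` is Valdivia compact. -/
theorem statement15 {I : Type u} {M : I → Type v}
    [∀ i, TopologicalSpace (M i)] [∀ i, CompactSpace (M i)] [∀ i, T2Space (M i)]
    [∀ i, TopologicalSpace.MetrizableSpace (M i)]
    {Y : Type w} [TopologicalSpace Y]
    (f : (∀ i, M i) → Y) (g : Y → ∀ i, M i)
    (hf : Continuous f) (hg : Continuous g) (hfg : f ∘ g = id) :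
    IsValdivia Y := by
  have hfg' : ∀ y, f (g y) = y := fun y => congrFun hfg y
  have : CompactSpace Y := by
    refine ⟨?_⟩
    have : range f = univ := (Function.LeftInverse.surjective hfg').range_eq
    rw [← this]
    exact isCompact_range hf
  rcases isEmpty_or_nonempty (∀ i, M i) with hX | ⟨⟨a⟩⟩
  · have hY : IsEmpty Y := ⟨fun y => hX.elim (g y)⟩
    exact rv_valdivia_of (T := Empty) (fun t => t.elim) (fun t => t.elim)
      (fun y => hY.elim y) (fun U _ y => hY.elim y)
  have : ∀ i, Nonempty (M i) := fun i => ⟨a i⟩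
  let r : (∀ i, M i) → ∀ i, M i := g ∘ f
  have hr : Continuous r := hg.comp hf
  have hrr : ∀ x, r (r x) = r x := fun x => congrArg g (hfg' (f x))
  have hrg : ∀ y, r (g y) = g y := fun y => congrArg g (hfg' y)
  obtain ⟨lo, wf, ρ, hρ, h1, h2⟩ := rv_rank r hr
  choose e hec hei using fun i => rv_coords (M i)
  let b : I → Y → ∀ i, M i := fun c y => r (rvMix {d | ρ d < ρ c} (g y) a)
  have hb : ∀ c, Continuous (b c) := fun c => hr.comp ((rvMix_continuous _ a).comp hg)
  let h : (I × ℕ) × Bool → Y → unitInterval := fun t y =>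
    if t.2 then projIcc (0 : ℝ) 1 zero_le_one
      ((e t.1.1 t.1.2 (g y t.1.1) : ℝ) - e t.1.1 t.1.2 (b t.1.1 y t.1.1))
    else projIcc (0 : ℝ) 1 zero_le_one
      ((e t.1.1 t.1.2 (b t.1.1 y t.1.1) : ℝ) - e t.1.1 t.1.2 (g y t.1.1))
  refine rv_valdivia_of h ?_ ?_ ?_
  · rintro ⟨⟨c, n⟩, t⟩
    have k1 : Continuous fun y => (e c n (g y c) : ℝ) :=
      continuous_subtype_val.comp ((hec c n).comp ((continuous_apply c).comp hg))
    have k2 : Continuous fun y => (e c n (b c y c) : ℝ) :=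
      continuous_subtype_val.comp ((hec c n).comp ((continuous_apply c).comp (hb c)))
    cases t
    · exact continuous_projIcc.comp (k2.sub k1)
    · exact continuous_projIcc.comp (k1.sub k2)
  · intro y y' hyy
    have main : ∀ j c, ρ c = j → g y c = g y' c := by
      intro j
      induction j using WellFoundedLT.induction with
      | _ j ih =>
      intro c hc
      have hbb : b c y = b c y' := by
        simp only [b]
        rw [rvMix_congr (x := g y) (x' := g y')]
        intro d hd
        exact ih (ρ d) (hc ▸ hd) d rfl
      refine hei c _ _ fun n => ?_
      have p1 := hyy ((c, n), true)
      have p2 := hyy ((c, n), false)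
      simp only [h, hbb] at p1 p2
      exact rv_proj p1 p2
    have : g y = g y' := funext fun c => main _ c rfl
    rw [← hfg' y, this, hfg']
  · intro U hU y hyU
    obtain ⟨z, hzU, hz, hzs⟩ := rv_dense r hr hrr ρ hρ h1 h2 a (f ⁻¹' U) (hU.preimage hf)
      (g y) (by simpa [hfg'] using hyU) (hrg y)
    refine ⟨f z, hzU, ((hzs.prod countable_univ).prod countable_univ).mono ?_⟩
    rintro ⟨⟨c, n⟩, t⟩ ht
    refine ⟨⟨?_, trivial⟩, trivial⟩
    have hgz : g (f z) = z := hz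
    intro hcz
    apply ht
    have : b c (f z) c = g (f z) c := by
      simp only [b, hgz]
      exact hcz.symm
    simp only [h, this, sub_self]
    cases t <;> simp [projIcc_left]
end
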